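/- (Nondefectivity and generic rank for Gaussian moment varieties.) Let n ≥ 2, d ≥ 5 and set N := n*(n+3)/2. Then the Gaussian moment variety GM_d(ℂ^n) ⊆ S^d_n satisfies dim GM_d(ℂ^n) = N; for every m ≥ 1 with N * (m + N) ≤ choose (n+d−1) d, the m-th secant variety σ_m GM_d(ℂ^n) has dimension exactly m * N; and for every m ≥ 1 with m * N ≥ choose (n+d−1) d + N^2, σ_m GM_d(ℂ^n) equals all of S^d_n. -/

import Mathlib

noncomputable section

open MvPolynomial

/-- The Zariski topology on a `ℂ`-vector space `M` (for finite-dimensional `M`,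
identified with a coordinate space via a basis, this is the topology in which a set
is closed iff it is the common zero locus of a family of polynomial functions
of the coordinates). -/
def ztV (M : Type*) [AddCommGroup M] [Module ℂ M] : TopologicalSpace M :=
  TopologicalSpace.generateFrom
    { U | ∃ (k : ℕ) (p : MvPolynomial (Fin k) ℂ) (L : Fin k → M →ₗ[ℂ] ℂ),
        U = { x | MvPolynomial.eval (fun i => L i x) p ≠ 0 } }

def zIsOpenV {M : Type*} [AddCommGroup M] [Module ℂ M] (S : Set M) : Prop :=
  @IsOpen _ (ztV M) S

def zClosureV {M : Type*} [AddCommGroup M] [Module ℂ M] (S : Set M) : Set M :=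
  @closure _ (ztV M) S

/-- The topological Krull dimension of `S` (with the subspace Zariski topology):
the supremum of lengths of chains of irreducible closed subsets. -/
def zDimV {M : Type*} [AddCommGroup M] [Module ℂ M] (S : Set M) : WithBot ℕ∞ :=
  @topologicalKrullDim ↥S (TopologicalSpace.induced Subtype.val (ztV M))

/-- The `m`-th secant variety: the Zariski closure of the set of sums of `m` points of `V`. -/
def secantV {M : Type*} [AddCommGroup M] [Module ℂ M] (m : ℕ) (V : Set M) : Set M :=
  zClosureV { p | ∃ x : Fin m → M, (∀ i, x i ∈ V) ∧ p = ∑ i, x i }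

/-- `V` is `m`-identifiable: there is a dense open subset `O` of `σ_m V` such that every
`p ∈ O` is a sum of `m` points of `V`, uniquely up to a permutation of the summands. -/
def IsIdentifiableV {M : Type*} [AddCommGroup M] [Module ℂ M] (m : ℕ) (V : Set M) : Prop :=
  ∃ O : Set M, O ⊆ secantV m V ∧
    (∃ U, zIsOpenV U ∧ O = U ∩ secantV m V) ∧
    secantV m V ⊆ zClosureV O ∧
    ∀ p ∈ O,
      (∃ x : Fin m → M, (∀ i, x i ∈ V) ∧ p = ∑ i, x i) ∧
      ∀ x y : Fin m → M, (∀ i, x i ∈ V) → (∀ i, y i ∈ V) →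
        p = ∑ i, x i → p = ∑ i, y i →
          ∃ e : Equiv.Perm (Fin m), ∀ i, y i = x (e i)

/-- The degree-`d` homogeneous component of `exp(ℓ + q/2)`:
`s_d(ℓ, q) = ∑_{j=0}^{⌊d/2⌋} (1 / (2^j j! (d-2j)!)) • ℓ^(d-2j) q^j`. -/
def sMoment (n d : ℕ) (ℓ q : MvPolynomial (Fin n) ℂ) : MvPolynomial (Fin n) ℂ :=
  ∑ j ∈ Finset.range (d / 2 + 1),
    ((1 : ℂ) / ((2 ^ j * Nat.factorial j * Nat.factorial (d - 2 * j) : ℕ) : ℂ)) •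
      (ℓ ^ (d - 2 * j) * q ^ j)

/-- The Gaussian moment variety: the Zariski closure in `S^d_n` of the set of all
`s_d(ℓ, q)` with `ℓ` a linear form and `q` a quadratic form. -/
def GMVariety (n d : ℕ) : Set ↥(homogeneousSubmodule (Fin n) ℂ d) :=
  zClosureV { f | ∃ ℓ q : MvPolynomial (Fin n) ℂ,
    ℓ ∈ homogeneousSubmodule (Fin n) ℂ 1 ∧ q ∈ homogeneousSubmodule (Fin n) ℂ 2 ∧
    (f : MvPolynomial (Fin n) ℂ) = sMoment n d ℓ q }

/-- The algebra of polynomial functions on a `ℂ`-vector space. -/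
def polyFun (P : Type*) [AddCommGroup P] [Module ℂ P] : Subalgebra ℂ (P → ℂ) :=
  Algebra.adjoin ℂ (Set.range fun (l : P →ₗ[ℂ] ℂ) => (l : P → ℂ))

/-- Polynomial maps between `ℂ`-vector spaces. -/
def IsPolyMap {P E : Type*} [AddCommGroup P] [Module ℂ P] [AddCommGroup E] [Module ℂ E]
    (φ : P → E) : Prop :=
  φ ∈ Submodule.span ℂ {ψ : P → E | ∃ f ∈ polyFun P, ∃ e : E, ψ = fun p => f p • e}

section PolyMap

variable {P E F G : Type*} [AddCommGroup P] [Module ℂ P] [AddCommGroup E] [Module ℂ E]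
  [AddCommGroup F] [Module ℂ F] [AddCommGroup G] [Module ℂ G]

lemma polyFun_linear (l : P →ₗ[ℂ] ℂ) : (l : P → ℂ) ∈ polyFun P :=
  Algebra.subset_adjoin ⟨l, rfl⟩

lemma polyFun_const (c : ℂ) : (fun _ : P => c) ∈ polyFun P :=
  (polyFun P).algebraMap_mem c

lemma polyFun_smul_isPolyMap {f : P → ℂ} (hf : f ∈ polyFun P) (e : E) :
    IsPolyMap fun p => f p • e :=
  Submodule.subset_span ⟨f, hf, e, rfl⟩

namespace IsPolyMap

lemma add {φ ψ : P → E} (hφ : IsPolyMap φ) (hψ : IsPolyMap ψ) :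
    IsPolyMap fun p => φ p + ψ p :=
  Submodule.add_mem _ hφ hψ

lemma sum {ι : Type*} (s : Finset ι) {φ : ι → P → E} (h : ∀ i ∈ s, IsPolyMap (φ i)) :
    IsPolyMap fun p => ∑ i ∈ s, φ i p := by
  have := Submodule.sum_mem _ h
  rwa [show (∑ i ∈ s, φ i) = fun p => ∑ i ∈ s, φ i p by ext p; simp] at this

lemma const_smul {φ : P → E} (hφ : IsPolyMap φ) (c : ℂ) : IsPolyMap fun p => c • φ p :=
  Submodule.smul_mem _ c hφ

lemma const (e : E) : IsPolyMap fun _ : P => e := by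
  simpa using polyFun_smul_isPolyMap (P := P) (polyFun_const 1) e

lemma linear_comp {φ : P → E} (hφ : IsPolyMap φ) (T : E →ₗ[ℂ] F) :
    IsPolyMap fun p => T (φ p) := by
  unfold IsPolyMap at hφ
  induction hφ using Submodule.span_induction with
  | mem ψ h =>
    obtain ⟨f, hf, e, rfl⟩ := h
    simpa using polyFun_smul_isPolyMap hf (T e)
  | zero => simpa using const (P := P) (0 : F)
  | add a b _ _ ha hb => simpa using ha.add hb
  | smul c a _ ha => simpa using ha.const_smul c

lemma smul {f : P → ℂ} (hf : f ∈ polyFun P) {φ : P → E} (hφ : IsPolyMap φ) :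
    IsPolyMap fun p => f p • φ p := by
  unfold IsPolyMap at hφ
  induction hφ using Submodule.span_induction with
  | mem ψ h =>
    obtain ⟨g, hg, e, rfl⟩ := h
    simpa [smul_smul] using polyFun_smul_isPolyMap ((polyFun P).mul_mem hf hg) e
  | zero => simpa using const (P := P) (0 : E)
  | add a b _ _ ha hb => simpa using ha.add hb
  | smul c a _ ha =>
    simpa [smul_comm c] using ha.const_smul c

lemma bilin {φ : P → E} {ψ : P → F} (hφ : IsPolyMap φ) (hψ : IsPolyMap ψ)
    (B : E →ₗ[ℂ] F →ₗ[ℂ] G) : IsPolyMap fun p => B (φ p) (ψ p) := by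
  unfold IsPolyMap at hφ
  induction hφ using Submodule.span_induction with
  | mem a h =>
    obtain ⟨g, hg, e, rfl⟩ := h
    simpa using (hψ.linear_comp (B e)).smul hg
  | zero => simpa using const (P := P) (0 : G)
  | add a b _ _ ha hb => simpa using ha.add hb
  | smul c a _ ha => simpa using ha.const_smul c

lemma mul {A : Type*} [CommRing A] [Algebra ℂ A] {φ ψ : P → A} (hφ : IsPolyMap φ)
    (hψ : IsPolyMap ψ) : IsPolyMap fun p => φ p * ψ p :=
  hφ.bilin hψ (LinearMap.mul ℂ A)

lemma pow {A : Type*} [CommRing A] [Algebra ℂ A] {φ : P → A} (hφ : IsPolyMap φ) (k : ℕ) :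
    IsPolyMap fun p => φ p ^ k := by
  induction k with
  | zero => simpa using const (P := P) (1 : A)
  | succ k ih => simpa [pow_succ] using ih.mul hφ

lemma mem_polyFun {φ : P → ℂ} (hφ : IsPolyMap φ) : φ ∈ polyFun P := by
  unfold IsPolyMap at hφ
  induction hφ using Submodule.span_induction with
  | mem a h =>
    obtain ⟨g, hg, e, rfl⟩ := h
    exact (polyFun P).mul_mem hg (polyFun_const e)
  | zero => exact (polyFun P).zero_mem
  | add a b _ _ ha hb => exact (polyFun P).add_mem ha hb
  | smul c a _ ha => exact (polyFun P).smul_mem ha c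

lemma polyFun_comp {φ : P → E} (hφ : IsPolyMap φ) {f : E → ℂ} (hf : f ∈ polyFun E) :
    (fun p => f (φ p)) ∈ polyFun P := by
  unfold polyFun at hf
  induction hf using Algebra.adjoin_induction with
  | mem f h =>
    obtain ⟨l, rfl⟩ := h
    exact (hφ.linear_comp l).mem_polyFun
  | algebraMap r => exact polyFun_const r
  | add f g _ _ hf hg => exact (polyFun P).add_mem hf hg
  | mul f g _ _ hf hg => exact (polyFun P).mul_mem hf hg

lemma comp {ψ : E → F} (hψ : IsPolyMap ψ) {φ : P → E} (hφ : IsPolyMap φ) :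
    IsPolyMap fun p => ψ (φ p) := by
  unfold IsPolyMap at hψ
  induction hψ using Submodule.span_induction with
  | mem a h =>
    obtain ⟨g, hg, e, rfl⟩ := h
    exact polyFun_smul_isPolyMap (hφ.polyFun_comp hg) e
  | zero => simpa using const (P := P) (0 : F)
  | add a b _ _ ha hb => simpa using ha.add hb
  | smul c a _ ha => simpa using ha.const_smul c

lemma linear [FiniteDimensional ℂ P] (T : P →ₗ[ℂ] E) : IsPolyMap fun p => T p := by
  have b := Module.finBasis ℂ P
  have h : (fun p => T p) = fun p => ∑ i, (b.coord i) p • T (b i) := by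
    ext p
    conv_lhs => rw [← b.sum_repr p, map_sum]
    simp
  rw [h]
  exact sum _ fun i _ => polyFun_smul_isPolyMap (polyFun_linear _) _

lemma prodMk {φ : P → E} {ψ : P → F} (hφ : IsPolyMap φ) (hψ : IsPolyMap ψ) :
    IsPolyMap fun p => (φ p, ψ p) := by
  simpa using (hφ.linear_comp (LinearMap.inl ℂ E F)).add (hψ.linear_comp (LinearMap.inr ℂ E F))

lemma codRestrict {S : Submodule ℂ E} {φ : P → S} (h : IsPolyMap fun p => (φ p : E)) :
    IsPolyMap φ := by
  obtain ⟨T, hT⟩ := S.subtype.exists_leftInverse_of_injective (by simp)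
  have := h.linear_comp T
  convert this using 2 with p
  exact (LinearMap.congr_fun hT (φ p)).symm

/-- The affine line through `u` with direction `v`, as a polynomial map. -/
lemma line (u v : E) : IsPolyMap fun t : ℂ => u + t • v :=
  (const u).add (polyFun_smul_isPolyMap (polyFun_linear LinearMap.id) v)

end IsPolyMap

lemma exists_polynomial_of_mem_polyFun {f : ℂ → ℂ} (hf : f ∈ polyFun ℂ) :
    ∃ p : Polynomial ℂ, ∀ t, f t = p.eval t := by
  unfold polyFun at hf
  induction hf using Algebra.adjoin_induction with
  | mem f h =>
    obtain ⟨l, rfl⟩ := h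
    refine ⟨Polynomial.C (l 1) * Polynomial.X, fun t => ?_⟩
    have := l.map_smul t 1
    rw [smul_eq_mul, mul_one, smul_eq_mul] at this
    rw [Polynomial.eval_mul, Polynomial.eval_C, Polynomial.eval_X, mul_comm]
    exact this
  | algebraMap r => exact ⟨Polynomial.C r, fun t => by simp⟩
  | add f g _ _ hf hg =>
    obtain ⟨p, hp⟩ := hf
    obtain ⟨q, hq⟩ := hg
    exact ⟨p + q, fun t => by simp [hp, hq]⟩
  | mul f g _ _ hf hg =>
    obtain ⟨p, hp⟩ := hf
    obtain ⟨q, hq⟩ := hg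
    exact ⟨p * q, fun t => by simp [hp, hq]⟩

/-- A polynomial function on the line with a nonzero value vanishes only finitely often. -/
lemma polyFun_eventually_ne {f : ℂ → ℂ} (hf : f ∈ polyFun ℂ) {t₀ : ℂ} (h : f t₀ ≠ 0) :
    ∀ᶠ t in Filter.cofinite, f t ≠ 0 := by
  obtain ⟨p, hp⟩ := exists_polynomial_of_mem_polyFun hf
  have hp0 : p ≠ 0 := by
    rintro rfl
    simp [hp] at h
  rw [Filter.eventually_cofinite]
  refine (p.roots.toFinset.finite_toSet).subset fun t ht => ?_
  simpa [hp0, hp] using ht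

lemma polyFun_eq_zero_of_eventually {f : ℂ → ℂ} (hf : f ∈ polyFun ℂ)
    (h : ∀ᶠ t in Filter.cofinite, f t = 0) (t : ℂ) : f t = 0 := by
  by_contra h0
  obtain ⟨s, hs, hs'⟩ := (h.and (polyFun_eventually_ne hf h0)).exists
  exact hs' hs

lemma mvPolynomial_eval_mem_polyFun {κ : Type*} (p : MvPolynomial κ ℂ) (L : κ → P →ₗ[ℂ] ℂ) :
    (fun x => MvPolynomial.eval (fun i => L i x) p) ∈ polyFun P := by
  induction p using MvPolynomial.induction_on with
  | C a => simpa using polyFun_const a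
  | add p q hp hq => simpa using! (polyFun P).add_mem hp hq
  | mul_X p i hp => simpa using! (polyFun P).mul_mem hp (polyFun_linear (L i))

lemma exists_mvPolynomial_of_mem_polyFun {κ : Type*} [Finite κ] (b : Module.Basis κ ℂ P)
    {f : P → ℂ} (hf : f ∈ polyFun P) :
    ∃ p : MvPolynomial κ ℂ, ∀ x, f x = MvPolynomial.eval (fun i => b.coord i x) p := by
  have := Fintype.ofFinite κ
  unfold polyFun at hf
  induction hf using Algebra.adjoin_induction with
  | mem f h =>
    obtain ⟨l, rfl⟩ := h
    refine ⟨∑ i, MvPolynomial.C (l (b i)) * MvPolynomial.X i, fun x => ?_⟩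
    have h : l x = ∑ i, b.repr x i * l (b i) := by
      conv_lhs => rw [← b.sum_repr x, map_sum]
      simp
    simpa [mul_comm] using! h
  | algebraMap r => exact ⟨MvPolynomial.C r, fun t => by simp⟩
  | add f g _ _ hf hg =>
    obtain ⟨p, hp⟩ := hf
    obtain ⟨q, hq⟩ := hg
    exact ⟨p + q, fun t => by simp [hp, hq]⟩
  | mul f g _ _ hf hg =>
    obtain ⟨p, hp⟩ := hf
    obtain ⟨q, hq⟩ := hg
    exact ⟨p * q, fun t => by simp [hp, hq]⟩

end PolyMap

section GeneralPosition

variable {P V : Type*} [AddCommGroup P] [Module ℂ P] [AddCommGroup V] [Module ℂ V]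

lemma eventually_linearIndependent {r : ℕ} {v : Fin r → ℂ → V} (hv : ∀ j, IsPolyMap (v j))
    {t₀ : ℂ} (h : LinearIndependent ℂ fun j => v j t₀) :
    ∀ᶠ t in Filter.cofinite, LinearIndependent ℂ fun j => v j t := by
  obtain ⟨T, hT⟩ := (Fintype.linearCombination ℂ fun j => v j t₀).exists_leftInverse_of_injective
    (LinearMap.ker_eq_bot.2 h.fintypeLinearCombination_injective)
  let D : ℂ → ℂ := fun t => (Matrix.of fun i j => T (v i t) j).det
  have hD : D ∈ polyFun ℂ := by
    have : D = fun t => ∑ σ : Equiv.Perm (Fin r),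
        (((Equiv.Perm.sign σ : ℤ) : ℂ)) • ∏ i, T (v (σ i) t) i := by
      ext t
      simp [D, Matrix.det_apply, Units.smul_def]
    rw [this]
    refine (IsPolyMap.sum _ fun σ _ => IsPolyMap.const_smul ?_ _).mem_polyFun
    have hp : (fun t => ∏ i, T (v (σ i) t) i) = ∏ i, fun t => T (v (σ i) t) i := by
      ext t
      simp
    have : (fun t => ∏ i, T (v (σ i) t) i) ∈ polyFun ℂ := by
      rw [hp]
      exact Subalgebra.prod_mem _ fun i _ =>
        ((hv (σ i)).linear_comp ((LinearMap.proj i).comp T)).mem_polyFun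
    simpa using polyFun_smul_isPolyMap this (1 : ℂ)
  have h0 : D t₀ ≠ 0 := by
    have : (Matrix.of fun i j => T (v i t₀) j) = 1 := by
      ext i j
      have := congrFun (LinearMap.congr_fun hT (Pi.single i 1)) j
      simp only [LinearMap.comp_apply, Fintype.linearCombination_apply_single] at this
      simpa [Matrix.one_apply, Pi.single_apply, eq_comm] using this
    simp [D, this]
  filter_upwards [polyFun_eventually_ne hD h0] with t ht
  exact LinearIndependent.of_comp T (Matrix.linearIndependent_rows_of_det_ne_zero ht)

/-- The sum of the images of the linear maps `L (p i)`, `i ∈ S`. -/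
def imageSum (L : P → P →ₗ[ℂ] V) {ι : Type*} (p : ι → P) (S : Finset ι) : Submodule ℂ V :=
  ⨆ i ∈ S, LinearMap.range (L (p i))

/-- The maximal dimension of the sum of the images of `k` of the linear maps `L p`. -/
def maxRank (L : P → P →ₗ[ℂ] V) (k : ℕ) : ℕ :=
  sSup (Set.range fun p : Fin k → P => Module.finrank ℂ (imageSum L p Finset.univ))

/-- All subfamilies of `p` span images of maximal dimension. -/
def InGeneralPosition (L : P → P →ₗ[ℂ] V) {ι : Type*} (p : ι → P) : Prop :=
  ∀ S : Finset ι, Module.finrank ℂ (imageSum L p S) = maxRank L S.card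

variable {L : P → P →ₗ[ℂ] V} {ι : Type*}

lemma range_le_imageSum (p : ι → P) {S : Finset ι} {i : ι} (hi : i ∈ S) :
    LinearMap.range (L (p i)) ≤ imageSum L p S :=
  le_iSup₂_of_le i hi le_rfl

lemma imageSum_mono (p : ι → P) {S S' : Finset ι} (h : S ⊆ S') :
    imageSum L p S ≤ imageSum L p S' :=
  iSup₂_le fun _ hi => range_le_imageSum p (h hi)

lemma imageSum_insert [DecidableEq ι] (p : ι → P) (S : Finset ι) (i : ι) :
    imageSum L p (insert i S) = LinearMap.range (L (p i)) ⊔ imageSum L p S := by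
  unfold imageSum
  exact Finset.iSup_insert _ _ _

lemma imageSum_map {κ : Type*} (p : ι → P) (e : κ ↪ ι) (S : Finset κ) :
    imageSum L p (S.map e) = imageSum L (p ∘ e) S := by
  refine le_antisymm (iSup₂_le fun i hi => ?_)
    (iSup₂_le fun i hi => range_le_imageSum p (Finset.mem_map_of_mem e hi))
  obtain ⟨j, hj, rfl⟩ := Finset.mem_map.1 hi
  exact range_le_imageSum (p ∘ e) hj

lemma mem_imageSum_iff (p : ι → P) (S : Finset ι) (w : V) :
    w ∈ imageSum L p S ↔ ∃ u : ι → P, w = ∑ i ∈ S, L (p i) (u i) := by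
  rw [imageSum, Submodule.mem_iSup_finset_iff_exists_sum]
  constructor
  · rintro ⟨μ, rfl⟩
    choose u hu using fun i => (μ i).2
    exact ⟨u, by simp [hu]⟩
  · rintro ⟨u, rfl⟩
    exact ⟨fun i => ⟨L (p i) (u i), u i, rfl⟩, rfl⟩

lemma imageSum_eq_imageSum_fin (p : ι → P) (S : Finset ι) :
    imageSum L p S = imageSum L (fun j => p (S.equivFin.symm j)) Finset.univ := by
  refine le_antisymm (iSup₂_le fun i hi => ?_) (iSup₂_le fun j _ => range_le_imageSum p (by simp))
  have := range_le_imageSum (L := L) (fun j => p (S.equivFin.symm j))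
    (Finset.mem_univ (S.equivFin ⟨i, hi⟩))
  simpa using this

lemma InGeneralPosition.finrank_range {p : ι → P} (hp : InGeneralPosition L p) (x : ι) :
    Module.finrank ℂ (LinearMap.range (L (p x))) = maxRank L 1 := by
  have := hp {x}
  rwa [show imageSum L p {x} = LinearMap.range (L (p x)) by simp [imageSum]] at this

variable [FiniteDimensional ℂ V]

lemma eventually_finrank_imageSum_le (hL : ∀ u, IsPolyMap fun p => L p u) {c : ℂ → ι → P}
    (hc : ∀ i, IsPolyMap fun t => c t i) (t₀ : ℂ) (S : Finset ι) :
    ∀ᶠ t in Filter.cofinite,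
      Module.finrank ℂ (imageSum L (c t₀) S) ≤ Module.finrank ℂ (imageSum L (c t) S) := by
  set b := Module.finBasis ℂ (imageSum L (c t₀) S)
  choose u hu using fun j => (mem_imageSum_iff (c t₀) S (b j : V)).1 (b j).2
  have hli : LinearIndependent ℂ fun j => ∑ i ∈ S, L (c t₀ i) (u j i) := by
    simp only [← hu]
    exact b.linearIndependent.map' (Submodule.subtype _) (by simp)
  filter_upwards [eventually_linearIndependent
    (v := fun j t => ∑ i ∈ S, L (c t i) (u j i))
    (fun j => IsPolyMap.sum _ fun i _ => (hL (u j i)).comp (hc i)) hli] with t ht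
  have hmem : ∀ j, ∑ i ∈ S, L (c t i) (u j i) ∈ imageSum L (c t) S :=
    fun j => (mem_imageSum_iff _ _ _).2 ⟨u j, rfl⟩
  have : LinearIndependent ℂ fun j => (⟨_, hmem j⟩ : imageSum L (c t) S) :=
    LinearIndependent.of_comp (Submodule.subtype _) ht
  simpa using this.fintype_card_le_finrank

lemma bddAbove_finrank_imageSum (L : P → P →ₗ[ℂ] V) (k : ℕ) : BddAbove
    (Set.range fun p : Fin k → P => Module.finrank ℂ (imageSum L p Finset.univ)) :=
  ⟨Module.finrank ℂ V, by rintro _ ⟨p, rfl⟩; exact Submodule.finrank_le _⟩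

lemma finrank_imageSum_le_maxRank (p : ι → P) (S : Finset ι) :
    Module.finrank ℂ (imageSum L p S) ≤ maxRank L S.card := by
  rw [imageSum_eq_imageSum_fin]
  exact le_csSup (bddAbove_finrank_imageSum L _) ⟨_, rfl⟩

lemma exists_finrank_imageSum_eq (L : P → P →ₗ[ℂ] V) (k : ℕ) :
    ∃ p : Fin k → P, Module.finrank ℂ (imageSum L p Finset.univ) = maxRank L k :=
  Nat.sSup_mem (Set.range_nonempty _) (bddAbove_finrank_imageSum L k)

lemma exists_finrank_imageSum_eq' (L : P → P →ₗ[ℂ] V) (S : Finset ι) :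
    ∃ p : ι → P, Module.finrank ℂ (imageSum L p S) = maxRank L S.card := by
  classical
  obtain ⟨p, hp⟩ := exists_finrank_imageSum_eq L S.card
  refine ⟨fun i => if h : i ∈ S then p (S.equivFin ⟨i, h⟩) else 0, ?_⟩
  rw [imageSum_eq_imageSum_fin, ← hp]
  suffices h : (fun j => if h : (S.equivFin.symm j : ι) ∈ S then
      p (S.equivFin ⟨S.equivFin.symm j, h⟩) else 0) = p by rw [h]
  funext j
  rw [dif_pos (S.equivFin.symm j).2, Subtype.coe_eta, Equiv.apply_symm_apply]

lemma maxRank_le_finrank (L : P → P →ₗ[ℂ] V) (k : ℕ) : maxRank L k ≤ Module.finrank ℂ V := by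
  obtain ⟨p, hp⟩ := exists_finrank_imageSum_eq L k
  exact hp ▸ Submodule.finrank_le _

lemma maxRank_zero (L : P → P →ₗ[ℂ] V) : maxRank L 0 = 0 := by
  obtain ⟨p, hp⟩ := exists_finrank_imageSum_eq L 0
  have : imageSum L p Finset.univ = ⊥ := eq_bot_iff.2 (iSup₂_le fun i _ => i.elim0)
  rw [← hp, this, finrank_bot]

lemma InGeneralPosition.eventually [Finite ι] (hL : ∀ u, IsPolyMap fun p => L p u)
    {c : ℂ → ι → P} (hc : ∀ i, IsPolyMap fun t => c t i) {t₀ : ℂ}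
    (h : InGeneralPosition L (c t₀)) : ∀ᶠ t in Filter.cofinite, InGeneralPosition L (c t) := by
  unfold InGeneralPosition
  rw [Filter.eventually_all]
  intro S
  filter_upwards [eventually_finrank_imageSum_le hL hc t₀ S] with t ht
  exact le_antisymm (finrank_imageSum_le_maxRank _ _) (h S ▸ ht)

lemma exists_inGeneralPosition [Finite ι] (hL : ∀ u, IsPolyMap fun p => L p u) :
    ∃ p : ι → P, InGeneralPosition L p := by
  classical
  have := Fintype.ofFinite ι
  suffices h : ∀ 𝒮 : Finset (Finset ι), ∃ p : ι → P, ∀ S ∈ 𝒮,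
      Module.finrank ℂ (imageSum L p S) = maxRank L S.card by
    obtain ⟨p, hp⟩ := h Finset.univ
    exact ⟨p, fun S => hp S (Finset.mem_univ S)⟩
  intro 𝒮
  induction 𝒮 using Finset.induction_on with
  | empty => exact ⟨0, by simp⟩
  | insert S 𝒮 _ ih =>
    obtain ⟨p, hp⟩ := ih
    obtain ⟨p', hp'⟩ := exists_finrank_imageSum_eq' L S
    let c : ℂ → ι → P := fun t i => p i + t • (p' i - p i)
    have hc : ∀ i, IsPolyMap fun t => c t i := fun i => IsPolyMap.line _ _
    have hc0 : c 0 = p := by ext i; simp [c]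
    have hc1 : c 1 = p' := by ext i; simp [c]
    have h1 : ∀ᶠ t in Filter.cofinite, ∀ S ∈ 𝒮,
        Module.finrank ℂ (imageSum L p S) ≤ Module.finrank ℂ (imageSum L (c t) S) :=
      (Filter.eventually_all_finset 𝒮).2 fun S _ =>
        hc0 ▸ eventually_finrank_imageSum_le hL hc 0 S
    have h2 := eventually_finrank_imageSum_le hL hc 1 S
    obtain ⟨t, ht1, ht2⟩ := (h1.and h2).exists
    refine ⟨c t, fun S' hS' => le_antisymm (finrank_imageSum_le_maxRank _ _) ?_⟩
    rcases Finset.mem_insert.1 hS' with rfl | hS'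
    · rwa [hc1, hp'] at ht2
    · exact hp S' hS' ▸ ht1 S' hS'

lemma InGeneralPosition.finrank_inf {p : ι → P} (hp : InGeneralPosition L p) {x : ι}
    {S : Finset ι} (hx : x ∉ S) :
    maxRank L (S.card + 1) +
      Module.finrank ℂ (LinearMap.range (L (p x)) ⊓ imageSum L p S : Submodule ℂ V) =
      maxRank L 1 + maxRank L S.card := by
  classical
  have := Submodule.finrank_sup_add_finrank_inf_eq (LinearMap.range (L (p x))) (imageSum L p S)
  rw [← imageSum_insert, hp, hp, Finset.card_insert_of_notMem hx, hp.finrank_range] at this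
  exact this

/-- The increments of `maxRank` are non-increasing. -/
lemma maxRank_concave (hL : ∀ u, IsPolyMap fun p => L p u) (k : ℕ) :
    maxRank L (k + 2) + maxRank L k ≤ 2 * maxRank L (k + 1) := by
  classical
  obtain ⟨p, hp⟩ := exists_inGeneralPosition (ι := Fin k ⊕ Bool) hL
  set S : Finset (Fin k ⊕ Bool) := Finset.univ.map Function.Embedding.inl
  have hS : S.card = k := by simp [S]
  have hT : (insert (Sum.inr true) S).card = k + 1 := by
    rw [Finset.card_insert_of_notMem (by simp [S]), hS]
  have h1 := hp.finrank_inf (x := Sum.inr false) (S := S) (by simp [S])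
  have h2 := hp.finrank_inf (x := Sum.inr false) (S := insert (Sum.inr true) S) (by simp [S])
  rw [hS] at h1
  rw [hT, show k + 1 + 1 = k + 2 from rfl] at h2
  have h3 : Module.finrank ℂ (LinearMap.range (L (p (Sum.inr false))) ⊓ imageSum L p S :
        Submodule ℂ V) ≤ Module.finrank ℂ (LinearMap.range (L (p (Sum.inr false))) ⊓
        imageSum L p (insert (Sum.inr true) S) : Submodule ℂ V) :=
    Submodule.finrank_mono (inf_le_inf_left _ (imageSum_mono p (Finset.subset_insert _ _)))
  omega

lemma InGeneralPosition.inf_insert [DecidableEq ι] {p : ι → P} (hp : InGeneralPosition L p)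
    {S : Finset ι}
    (hr : maxRank L (S.card + 2) + maxRank L S.card = 2 * maxRank L (S.card + 1))
    {x b : ι} (hb : b ∉ S) (hxb : x ≠ b) (hx : x ∉ S) :
    LinearMap.range (L (p x)) ⊓ imageSum L p (insert b S) =
      LinearMap.range (L (p x)) ⊓ imageSum L p S := by
  have h1 := hp.finrank_inf hx
  have h2 := hp.finrank_inf (x := x) (S := insert b S) (by simp [hxb, hx])
  rw [Finset.card_insert_of_notMem hb, show S.card + 1 + 1 = S.card + 2 from rfl] at h2
  refine (Submodule.eq_of_le_of_finrank_eq
    (inf_le_inf_left _ (imageSum_mono p (Finset.subset_insert _ _))) ?_).symm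
  omega

/-- If two consecutive increments of `maxRank` agree, then the intersection of the image at `x`
with the sum of the images over a set of given size does not depend on that set. -/
lemma InGeneralPosition.inf_le_imageSum {p : ι → P} (hp : InGeneralPosition L p) {k : ℕ}
    (hr : maxRank L (k + 2) + maxRank L k = 2 * maxRank L (k + 1)) {x : ι} {S S' : Finset ι}
    (hS : S.card = k) (hS' : S'.card = k) (hx : x ∉ S) (hx' : x ∉ S') :
    LinearMap.range (L (p x)) ⊓ imageSum L p S ≤ imageSum L p S' := by
  classical
  induction h : (S \ S').card generalizing S with
  | zero =>
    rw [Finset.card_eq_zero, Finset.sdiff_eq_empty_iff_subset] at h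
    rw [Finset.eq_of_subset_of_card_le h (by omega)]
    exact inf_le_right
  | succ j ih =>
    obtain ⟨a, ha⟩ : (S \ S').Nonempty := Finset.card_pos.1 (by omega)
    obtain ⟨b, hb⟩ : (S' \ S).Nonempty := Finset.card_pos.1 <| by
      have := Finset.card_sdiff_add_card_inter S S'
      have := Finset.card_sdiff_add_card_inter S' S
      rw [Finset.inter_comm] at this
      omega
    rw [Finset.mem_sdiff] at ha hb
    have hab : a ≠ b := fun h => hb.2 (h ▸ ha.1)
    have hxb : x ≠ b := fun h => hx' (h ▸ hb.1)
    have hxa : x ≠ a := fun h => hx (h ▸ ha.1)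
    have hb' : b ∉ S.erase a := fun h => hb.2 (Finset.mem_of_mem_erase h)
    have hcard : (insert b (S.erase a)).card = k := by
      rw [Finset.card_insert_of_notMem hb', Finset.card_erase_add_one ha.1, hS]
    have hxS : x ∉ insert b (S.erase a) := by simp [hxb, hx]
    have ha' : a ∉ insert b (S.erase a) := by simp [hab]
    have hins : insert a (insert b (S.erase a)) = insert b S := by
      rw [Finset.insert_comm, Finset.insert_erase ha.1]
    calc LinearMap.range (L (p x)) ⊓ imageSum L p S
        ≤ LinearMap.range (L (p x)) ⊓ imageSum L p (insert a (insert b (S.erase a))) := by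
          rw [hins]
          exact inf_le_inf_left _ (imageSum_mono p (Finset.subset_insert _ _))
      _ = LinearMap.range (L (p x)) ⊓ imageSum L p (insert b (S.erase a)) :=
          hp.inf_insert (by rw [hcard]; exact hr) ha' hxa hxS
      _ ≤ imageSum L p S' := by
          refine ih hcard hxS ?_
          have : insert b (S.erase a) \ S' = (S \ S').erase a := by
            rw [Finset.insert_sdiff_of_mem _ hb.1, Finset.erase_sdiff_comm]
          rw [this, Finset.card_erase_of_mem (by simpa using ha), h]
          rfl

/-- If the family `L` is equivariant under a family of linear maps acting irreducibly, then two
consecutive increments of `maxRank` can only agree if they are maximal or if the whole space has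
been filled. -/
lemma maxRank_eq_finrank_of_increments_eq {M : Type*} [AddCommGroup M] [Module ℂ M]
    (hL : ∀ u, IsPolyMap fun p => L p u) (aP : M → P → P) (aV : M → V →ₗ[ℂ] V) (e : M)
    (haP : ∀ g p, IsPolyMap fun t : ℂ => aP (e + t • g) p)
    (haV : ∀ g v, IsPolyMap fun t : ℂ => aV (e + t • g) v)
    (heP : ∀ p, aP e p = p)
    (hequi : ∀ g p u, aV g (L p u) ∈ LinearMap.range (L (aP g p)))
    (hirr : ∀ v ≠ 0, ∀ W : Submodule ℂ V, (∀ g, aV g v ∈ W) → W = ⊤) {k : ℕ}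
    (hr : maxRank L (k + 2) + maxRank L k = 2 * maxRank L (k + 1))
    (hk : maxRank L (k + 1) < maxRank L k + maxRank L 1) :
    maxRank L k = Module.finrank ℂ V := by
  classical
  obtain ⟨p, hp⟩ := exists_inGeneralPosition (ι := (Fin k ⊕ Fin k) ⊕ Unit) hL
  set x : (Fin k ⊕ Fin k) ⊕ Unit := Sum.inr ()
  set Y : Finset ((Fin k ⊕ Fin k) ⊕ Unit) :=
    (Finset.univ.map Function.Embedding.inl).map Function.Embedding.inl
  set Z : Finset ((Fin k ⊕ Fin k) ⊕ Unit) :=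
    (Finset.univ.map Function.Embedding.inr).map Function.Embedding.inl
  have hY : Y.card = k := by simp [Y]
  have hZ : Z.card = k := by simp [Z]
  have hxY : x ∉ Y := by simp [x, Y]
  have hxZ : x ∉ Z := by simp [x, Z]
  have hfin := hp.finrank_inf hxY
  rw [hY] at hfin
  obtain ⟨v, hv, hv0⟩ := Submodule.exists_mem_ne_zero_of_ne_bot
    (p := LinearMap.range (L (p x)) ⊓ imageSum L p Y) (by
      intro h
      rw [h, finrank_bot] at hfin
      omega)
  have key : ∀ g, aV g v ∈ imageSum L p Y := by
    intro g
    let c₁ : ℂ → (Fin k ⊕ Fin k) ⊕ Unit → P := fun t =>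
      Sum.elim (Sum.elim (fun i => aP (e + t • (g - e)) (p (Sum.inl (Sum.inl i))))
        fun i => p (Sum.inl (Sum.inr i))) fun _ => aP (e + t • (g - e)) (p x)
    let c₂ : ℂ → (Fin k ⊕ Fin k) ⊕ Unit → P := fun t =>
      Sum.elim (fun i => p (Sum.inl i)) fun _ => aP (e + t • (g - e)) (p x)
    have hc₁ : ∀ i, IsPolyMap fun t => c₁ t i := by
      rintro ((i | i) | i)
      · exact haP _ _
      · exact IsPolyMap.const _
      · exact haP _ _
    have hc₂ : ∀ i, IsPolyMap fun t => c₂ t i := by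
      rintro (i | i)
      · exact IsPolyMap.const _
      · exact haP _ _
    have h₁ : c₁ 0 = p := by
      ext ((i | i) | i) <;> simp [c₁, heP, x]
    have h₂ : c₂ 0 = p := by
      ext (i | i) <;> simp [c₂, heP, x]
    have hev : ∀ᶠ t : ℂ in Filter.cofinite, aV (e + t • (g - e)) v ∈ imageSum L p Y := by
      filter_upwards [InGeneralPosition.eventually hL hc₁ (h₁.symm ▸ hp),
        InGeneralPosition.eventually hL hc₂ (h₂.symm ▸ hp)] with t ht₁ ht₂
      have hx : aV (e + t • (g - e)) v ∈ LinearMap.range (L (c₂ t x)) := by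
        obtain ⟨u, hu⟩ := hv.1
        exact hu ▸ hequi _ _ _
      have hYt : aV (e + t • (g - e)) v ∈ imageSum L (c₁ t) Y := by
        obtain ⟨u, hu⟩ := (mem_imageSum_iff _ _ _).1 hv.2
        rw [hu, map_sum]
        refine Submodule.sum_mem _ fun i hi => range_le_imageSum _ hi ?_
        obtain ⟨i, rfl⟩ : ∃ i', i = Sum.inl (Sum.inl i') := by
          simp only [Y, Finset.mem_map, Finset.mem_univ, true_and] at hi
          grind [Function.Embedding.inl_apply]
        exact hequi _ _ _
      have hZt : aV (e + t • (g - e)) v ∈ imageSum L (c₁ t) Z :=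
        ht₁.inf_le_imageSum hr hY hZ hxY hxZ ⟨hx, hYt⟩
      have hZ₁₂ : imageSum L (c₁ t) Z = imageSum L (c₂ t) Z := by
        simp only [Z, imageSum_map]
        rfl
      have := ht₂.inf_le_imageSum hr hZ hY hxZ hxY ⟨hx, hZ₁₂ ▸ hZt⟩
      have hY₂ : imageSum L (c₂ t) Y = imageSum L p Y := by
        simp only [Y, imageSum_map]
        rfl
      exact hY₂ ▸ this
    by_contra hg
    obtain ⟨l, hl, hlW⟩ := Submodule.exists_le_ker_of_notMem hg
    have := polyFun_eq_zero_of_eventually ((haV (g - e) v).linear_comp l).mem_polyFun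
      (hev.mono fun t ht => hlW ht) 1
    simp only [one_smul, add_sub_cancel] at this
    exact hl this
  have hW := hp Y
  rw [hirr v hv0 _ key, finrank_top, hY] at hW
  exact hW.symm

end GeneralPosition

section ConcaveSequence

/-- A bounded monotone concave sequence of naturals starting with slope `N`, whose slope can only
repeat while it equals `N` or after the bound is attained, is linear up to some `k` and attains
the bound at `k + N`. -/
lemma exists_linear_and_eq_bound {r : ℕ → ℕ} {N D : ℕ} (hN : 0 < N) (h0 : r 0 = 0) (h1 : r 1 = N)
    (hmono : ∀ k, r k ≤ r (k + 1)) (hD : ∀ k, r k ≤ D)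
    (hconc : ∀ k, r (k + 2) + r k ≤ 2 * r (k + 1))
    (heq : ∀ k, r (k + 2) + r k = 2 * r (k + 1) → r (k + 1) < r k + N → r k = D) :
    ∃ k, (∀ j ≤ k, r j = j * N) ∧ r (k + N) = D := by
  have hle : ∀ k, r (k + 1) ≤ r k + N := by
    intro k
    induction k with
    | zero => simp [h0, h1]
    | succ k ih =>
      have := hconc k
      rw [show k + 1 + 1 = k + 2 from rfl]
      omega
  have hex : ∃ k, r (k + 1) < r k + N := by
    by_contra! h
    have hlin : ∀ k, r k = k * N := by
      intro k
      induction k with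
      | zero => simp [h0]
      | succ k ih => rw [le_antisymm (hle k) (h k), ih]; ring
    have := hD (D + 1)
    rw [hlin] at this
    nlinarith
  classical
  refine ⟨Nat.find hex, fun j hj => ?_, ?_⟩
  · induction j with
    | zero => simp [h0]
    | succ j ih =>
      have := Nat.find_min hex (m := j) (by omega)
      rw [le_antisymm (hle j) (not_lt.1 this), ih (by omega)]
      ring
  · set k := Nat.find hex
    have hk : r (k + 1) < r k + N := Nat.find_spec hex
    have key : ∀ j, r (k + j + 1) + 1 + j ≤ r (k + j) + N ∨ r (k + j) = D := by
      intro j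
      induction j with
      | zero => left; simpa using hk
      | succ j ih =>
        have e1 := hmono (k + j)
        have e2 := hD (k + j + 1)
        have e3 := hconc (k + j)
        have e4 := heq (k + j)
        rw [show k + (j + 1) + 1 = k + j + 2 by ring, show k + (j + 1) = k + j + 1 by ring]
        omega
    have := key N
    have := hmono (k + N)
    omega

end ConcaveSequence

section MaxRank

variable {P V : Type*} [AddCommGroup P] [Module ℂ P] [AddCommGroup V] [Module ℂ V]
  [FiniteDimensional ℂ V] {L : P → P →ₗ[ℂ] V}

lemma maxRank_le_succ (hL : ∀ u, IsPolyMap fun p => L p u) (k : ℕ) :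
    maxRank L k ≤ maxRank L (k + 1) := by
  obtain ⟨p, hp⟩ := exists_inGeneralPosition (ι := Option (Fin k)) hL
  have h := hp.finrank_inf (x := none) (S := Finset.univ.map Function.Embedding.some) (by simp)
  have h1 := hp.finrank_range none
  have h2 : Module.finrank ℂ (LinearMap.range (L (p none)) ⊓
      imageSum L p (Finset.univ.map Function.Embedding.some) : Submodule ℂ V) ≤
      Module.finrank ℂ (LinearMap.range (L (p none))) := Submodule.finrank_mono inf_le_left
  simp only [Finset.card_map, Finset.card_univ, Fintype.card_fin] at h
  omega

end MaxRank

section ZariskiTopology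

open scoped Topology

variable {P V : Type*} [AddCommGroup P] [Module ℂ P] [AddCommGroup V] [Module ℂ V]

lemma exists_polyFun_of_isOpen {U : Set V} (hU : IsOpen[ztV V] U) {x : V} (hx : x ∈ U) :
    ∃ f ∈ polyFun V, f x ≠ 0 ∧ ∀ y, f y ≠ 0 → y ∈ U := by
  induction hU with
  | basic s hs =>
    obtain ⟨k, p, L, rfl⟩ := hs
    exact ⟨_, mvPolynomial_eval_mem_polyFun p L, hx, fun y hy => hy⟩
  | univ => exact ⟨1, (polyFun V).one_mem, by simp, fun y _ => trivial⟩
  | inter s t _ _ hs ht =>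
    obtain ⟨f, hf, hfx, hfs⟩ := hs hx.1
    obtain ⟨g, hg, hgx, hgt⟩ := ht hx.2
    refine ⟨f * g, (polyFun V).mul_mem hf hg, mul_ne_zero hfx hgx, fun y hy => ?_⟩
    exact ⟨hfs y (left_ne_zero_of_mul hy), hgt y (right_ne_zero_of_mul hy)⟩
  | sUnion S _ ih =>
    obtain ⟨s, hs, hxs⟩ := hx
    obtain ⟨f, hf, hfx, hfs⟩ := ih s hs hxs
    exact ⟨f, hf, hfx, fun y hy => ⟨s, hs, hfs y hy⟩⟩

/-- The ambient space with its Zariski topology is irreducible. -/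
lemma isIrreducible_univ_ztV : @IsIrreducible P (ztV P) Set.univ := by
  refine ⟨⟨0, trivial⟩, ?_⟩
  rintro A B hA hB ⟨x, -, hx⟩ ⟨y, -, hy⟩
  obtain ⟨f, hf, hfx, hfA⟩ := exists_polyFun_of_isOpen hA hx
  obtain ⟨g, hg, hgy, hgB⟩ := exists_polyFun_of_isOpen hB hy
  have h1 := polyFun_eventually_ne ((IsPolyMap.line x (y - x)).polyFun_comp hf) (t₀ := 0)
    (by simpa using hfx)
  have h2 := polyFun_eventually_ne ((IsPolyMap.line x (y - x)).polyFun_comp hg) (t₀ := 1)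
    (by simpa using hgy)
  obtain ⟨t, ht1, ht2⟩ := (h1.and h2).exists
  exact ⟨_, trivial, hfA _ ht1, hgB _ ht2⟩

variable [FiniteDimensional ℂ V]

lemma isOpen_polyFun_ne {f : V → ℂ} (hf : f ∈ polyFun V) : IsOpen[ztV V] {x | f x ≠ 0} := by
  obtain ⟨p, hp⟩ := exists_mvPolynomial_of_mem_polyFun (Module.finBasis ℂ V) hf
  refine TopologicalSpace.isOpen_generateFrom_of_mem
    ⟨_, p, fun i => (Module.finBasis ℂ V).coord i, ?_⟩
  ext x
  simp [hp]

lemma isClosed_polyFun_eq_zero {f : V → ℂ} (hf : f ∈ polyFun V) :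
    IsClosed[ztV V] {x | f x = 0} :=
  (@isOpen_compl_iff _ _ (ztV V)).1 (isOpen_polyFun_ne hf)

/-- The Zariski closure is the common zero locus of the vanishing polynomial functions. -/
lemma mem_zClosureV_iff {S : Set V} {x : V} :
    x ∈ zClosureV S ↔ ∀ f ∈ polyFun V, (∀ y ∈ S, f y = 0) → f x = 0 := by
  let _ := ztV V
  constructor
  · intro hx f hf hS
    exact closure_minimal hS (isClosed_polyFun_eq_zero hf) hx
  · intro h
    by_contra hx
    obtain ⟨f, hf, hfx, hfU⟩ := exists_polyFun_of_isOpen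
      (isOpen_compl_iff.2 (isClosed_closure (s := S))) hx
    refine hfx (h f hf fun y hy => ?_)
    by_contra hfy
    exact hfU y hfy (subset_closure hy)

lemma IsPolyMap.continuous_ztV {W : Type*} [AddCommGroup W] [Module ℂ W] {φ : V → W}
    (hφ : IsPolyMap φ) : Continuous[ztV V, ztV W] φ := by
  refine continuous_generateFrom_iff.2 ?_
  rintro _ ⟨k, p, L, rfl⟩
  exact isOpen_polyFun_ne (hφ.polyFun_comp (mvPolynomial_eval_mem_polyFun p L))

lemma subset_zClosureV (S : Set V) : S ⊆ zClosureV S :=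
  fun _ hx => mem_zClosureV_iff.2 fun _ _ h => h _ hx

lemma zClosureV_mono {S T : Set V} (h : S ⊆ T) : zClosureV S ⊆ zClosureV T :=
  fun _ hx => mem_zClosureV_iff.2 fun f hf hT => mem_zClosureV_iff.1 hx f hf fun y hy => hT y (h hy)

/-- Replacing a set by its closure does not change its secant varieties. -/
lemma secantV_zClosureV (m : ℕ) (S : Set V) : secantV m (zClosureV S) = secantV m S := by
  classical
  refine Set.Subset.antisymm (fun x hx => mem_zClosureV_iff.2 fun f hf hS => ?_)
    (zClosureV_mono ?_)
  · refine mem_zClosureV_iff.1 hx f hf ?_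
    suffices h : ∀ T : Finset (Fin m), ∀ z : Fin m → V, (∀ i ∈ T, z i ∈ zClosureV S) →
        (∀ i ∉ T, z i ∈ S) → f (∑ i, z i) = 0 by
      rintro _ ⟨z, hz, rfl⟩
      exact h Finset.univ z (fun i _ => hz i) fun i hi => absurd (Finset.mem_univ i) hi
    intro T
    induction T using Finset.induction_on with
    | empty => exact fun z _ hz => hS _ ⟨z, fun i => hz i (by simp), rfl⟩
    | insert a T ha ih =>
      intro z hz hz'
      have hsum : ∀ w : V, ∑ i, Function.update z a w i = (∑ i ∈ Finset.univ.erase a, z i) + w := by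
        intro w
        rw [← Finset.sum_erase_add _ _ (Finset.mem_univ a), Function.update_self]
        congr 1
        exact Finset.sum_congr rfl fun i hi => Function.update_of_ne (Finset.ne_of_mem_erase hi) _ _
      have hg : (fun w => f ((∑ i ∈ Finset.univ.erase a, z i) + w)) ∈ polyFun V :=
        ((IsPolyMap.const _).add (IsPolyMap.linear LinearMap.id)).polyFun_comp hf
      have := mem_zClosureV_iff.1 (hz a (by simp)) _ hg fun w hw => by
        rw [← hsum]
        refine ih _ (fun i hi => ?_) fun i hi => ?_
        · rw [Function.update_of_ne (by rintro rfl; exact ha hi)]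
          exact hz i (by simp [hi])
        · by_cases hia : i = a
          · subst hia
            simpa using hw
          · rw [Function.update_of_ne hia]
            exact hz' i (by simp [hia, hi])
      rwa [← hsum, Function.update_eq_self] at this
  · rintro _ ⟨z, hz, rfl⟩
    exact ⟨z, fun i => subset_zClosureV S (hz i), rfl⟩

end ZariskiTopology

section Dominant

variable {P V : Type*} [AddCommGroup P] [Module ℂ P] [AddCommGroup V] [Module ℂ V]

/-- The polynomial curve `f` has the given value and derivative at the origin. -/
def HasLinearPart (f : ℂ → V) (a a' : V) : Prop :=
  ∃ ψ : ℂ → V, IsPolyMap ψ ∧ ∀ t, f t = a + t • a' + t ^ 2 • ψ t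

lemma HasLinearPart.linear_comp {W : Type*} [AddCommGroup W] [Module ℂ W] {f : ℂ → V} {a a' : V}
    (h : HasLinearPart f a a') (T : V →ₗ[ℂ] W) :
    HasLinearPart (fun t => T (f t)) (T a) (T a') := by
  obtain ⟨ψ, hψ, h⟩ := h
  exact ⟨_, hψ.linear_comp T, fun t => by simp [h]⟩

lemma HasLinearPart.hasDerivAt {f : ℂ → ℂ} {a a' : ℂ} (h : HasLinearPart f a a') :
    HasDerivAt f a' 0 := by
  obtain ⟨ψ, hψ, h⟩ := h
  obtain ⟨p, hp⟩ := exists_polynomial_of_mem_polyFun hψ.mem_polyFun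
  have hf : f = fun t => (Polynomial.C a + Polynomial.C a' * Polynomial.X +
      Polynomial.X ^ 2 * p).eval t := by
    ext t
    simp [h, hp, mul_comm t a']
  rw [hf]
  exact (Polynomial.hasDerivAt _ 0).congr_deriv (by simp)

lemma polyFun_eq_zero_of_eventually_nhds {D : ℕ} {f : (Fin D → ℂ) → ℂ}
    (hf : f ∈ polyFun (Fin D → ℂ)) {x : Fin D → ℂ} (h : ∀ᶠ y in nhds x, f y = 0) : f = 0 := by
  ext y
  have hc : Filter.Tendsto (fun t : ℂ => x + t • (y - x)) (nhds 0) (nhds x) := by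
    have : Continuous fun t : ℂ => x + t • (y - x) := by fun_prop
    simpa using this.tendsto 0
  by_contra hy
  have h1 := polyFun_eventually_ne ((IsPolyMap.line x (y - x)).polyFun_comp hf) (t₀ := 1)
    (by simpa using hy)
  have h2 : ∀ᶠ t in nhdsWithin (0 : ℂ) {0}ᶜ, f (x + t • (y - x)) = 0 :=
    (hc.eventually h).filter_mono nhdsWithin_le_nhds
  have h3 := h1.filter_mono (nhdsNE_le_cofinite (0 : ℂ))
  obtain ⟨t, ht, ht'⟩ := (h2.and h3).exists
  exact ht' ht

lemma eval_aeval_eq {σ τ : Type*} (F : σ → MvPolynomial τ ℂ) (x : τ → ℂ)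
    (q : MvPolynomial σ ℂ) : MvPolynomial.eval x (MvPolynomial.aeval F q) =
      MvPolynomial.eval (fun j => MvPolynomial.eval x (F j)) q := by
  induction q using MvPolynomial.induction_on <;> simp_all

lemma exists_mvPolynomial_of_isPolyMap {K D : ℕ} {φ : (Fin K → ℂ) → Fin D → ℂ}
    (hφ : IsPolyMap φ) :
    ∃ F : Fin D → MvPolynomial (Fin K) ℂ, ∀ x j, φ x j = MvPolynomial.eval x (F j) := by
  choose F hF using fun j => exists_mvPolynomial_of_mem_polyFun (Pi.basisFun ℂ (Fin K))
    (hφ.linear_comp (LinearMap.proj j)).mem_polyFun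
  refine ⟨F, fun x j => ?_⟩
  simpa using hF j x

lemma polyFun_eq_zero_of_comp_eq_zero_fin {K D : ℕ} {φ : (Fin K → ℂ) → Fin D → ℂ}
    (hφ : IsPolyMap φ) (p : Fin K → ℂ) (T : (Fin K → ℂ) →ₗ[ℂ] (Fin D → ℂ))
    (hT : Function.Surjective T) (hφT : ∀ v, HasLinearPart (fun t => φ (p + t • v)) (φ p) (T v))
    {f : (Fin D → ℂ) → ℂ} (hf : f ∈ polyFun (Fin D → ℂ)) (h : ∀ x, f (φ x) = 0) : f = 0 := by
  obtain ⟨F, hF⟩ := exists_mvPolynomial_of_isPolyMap hφ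
  have han : AnalyticAt ℂ φ p := by
    rw [analyticAt_pi_iff]
    intro j
    simp only [hF]
    exact AnalyticOnNhd.eval_mvPolynomial (F j) p trivial
  have hstr := han.hasStrictFDerivAt
  have hder : ∀ v, fderiv ℂ φ p v = T v := by
    intro v
    ext j
    have h1 : HasDerivAt (fun t : ℂ => φ (p + t • v) j) (fderiv ℂ φ p v j) 0 := by
      have hl : HasDerivAt (fun t : ℂ => p + t • v) v 0 := by
        simpa using ((hasDerivAt_id (0 : ℂ)).smul_const v).const_add p
      have hd : HasFDerivAt φ (fderiv ℂ φ p) (p + (0 : ℂ) • v) := by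
        simpa using hstr.hasFDerivAt
      exact hasDerivAt_pi.1 (hd.comp_hasDerivAt 0 hl) j
    exact h1.unique ((hφT v).linear_comp (LinearMap.proj j)).hasDerivAt
  have hsurj : (fderiv ℂ φ p).range = ⊤ := by
    rw [LinearMap.range_eq_top]
    intro w
    obtain ⟨v, hv⟩ := hT w
    exact ⟨v, by rw [← hv]; exact hder v⟩
  refine polyFun_eq_zero_of_eventually_nhds hf (x := φ p) ?_
  rw [← hstr.map_nhds_eq_of_surj hsurj]
  exact Filter.eventually_map.2 (Filter.Eventually.of_forall h)

variable [FiniteDimensional ℂ P] [FiniteDimensional ℂ V]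

/-- A polynomial map with surjective derivative at some point is dominant. -/
lemma polyFun_eq_zero_of_comp_eq_zero {φ : P → V} (hφ : IsPolyMap φ) (p : P) (T : P →ₗ[ℂ] V)
    (hT : Function.Surjective T) (hφT : ∀ v, HasLinearPart (fun t => φ (p + t • v)) (φ p) (T v))
    {f : V → ℂ} (hf : f ∈ polyFun V) (h : ∀ x, f (φ x) = 0) : f = 0 := by
  let a := (Module.finBasis ℂ P).equivFun
  let b := (Module.finBasis ℂ V).equivFun
  have hf' := (IsPolyMap.linear b.symm.toLinearMap).polyFun_comp hf
  have := polyFun_eq_zero_of_comp_eq_zero_fin (φ := fun x => b (φ (a.symm x)))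
    ((hφ.comp (IsPolyMap.linear a.symm.toLinearMap)).linear_comp b.toLinearMap) (a p)
    (b.toLinearMap ∘ₗ T ∘ₗ a.symm.toLinearMap)
    (b.surjective.comp (hT.comp a.symm.surjective))
    (fun v => by simpa using (hφT (a.symm v)).linear_comp b.toLinearMap) hf' (by simp [h])
  ext y
  simpa using congrFun this (b y)

lemma zClosureV_range_eq_univ {φ : P → V} (hφ : IsPolyMap φ) (p : P) (T : P →ₗ[ℂ] V)
    (hT : Function.Surjective T)
    (hφT : ∀ v, HasLinearPart (fun t => φ (p + t • v)) (φ p) (T v)) :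
    zClosureV (Set.range φ) = Set.univ := by
  refine Set.eq_univ_of_forall fun x => mem_zClosureV_iff.2 fun f hf h => ?_
  rw [polyFun_eq_zero_of_comp_eq_zero hφ p T hT hφT hf fun x => h _ ⟨x, rfl⟩]
  rfl

/-- A polynomial map to a space of larger dimension is not dominant. -/
lemma exists_polyFun_comp_eq_zero {φ : P → V} (hφ : IsPolyMap φ)
    (h : Module.finrank ℂ P < Module.finrank ℂ V) :
    ∃ f ∈ polyFun V, f ≠ 0 ∧ ∀ x, f (φ x) = 0 := by
  let a := (Module.finBasis ℂ P).equivFun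
  let b := (Module.finBasis ℂ V).equivFun
  obtain ⟨F, hF⟩ := exists_mvPolynomial_of_isPolyMap (φ := fun x => b (φ (a.symm x)))
    ((hφ.comp (IsPolyMap.linear a.symm.toLinearMap)).linear_comp b.toLinearMap)
  have hnot : ¬ AlgebraicIndependent ℂ F := by
    intro hind
    have := hind.lift_cardinalMk_le_trdeg
    rw [MvPolynomial.trdeg_of_isDomain] at this
    simp only [Cardinal.mk_fin, Cardinal.lift_natCast, Nat.cast_le] at this
    omega
  rw [algebraicIndependent_iff] at hnot
  push Not at hnot
  obtain ⟨q, hq, hq0⟩ := hnot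
  refine ⟨fun y => MvPolynomial.eval (b y) q, ?_, ?_, ?_⟩
  · exact mvPolynomial_eval_mem_polyFun q fun i => (LinearMap.proj i).comp b.toLinearMap
  · intro h0
    refine hq0 (MvPolynomial.funext fun y => ?_)
    simpa using congrFun h0 (b.symm y)
  · intro x
    have h1 : b (φ x) = fun j => MvPolynomial.eval (a x) (F j) := by
      ext j
      simpa using hF (a x) j
    have h2 := congrArg (MvPolynomial.eval (a x)) hq
    rw [eval_aeval_eq, map_zero] at h2
    simp only [h1]
    exact h2

end Dominant

section Dimension

/-- The Krull dimension of the image of a polynomial ring in a polynomial ring in `K` variables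
is at most `K`. -/
lemma ringKrullDim_quotient_ker_le {D K : ℕ}
    (g : MvPolynomial (Fin D) ℂ →ₐ[ℂ] MvPolynomial (Fin K) ℂ) :
    ringKrullDim (MvPolynomial (Fin D) ℂ ⧸ RingHom.ker g) ≤ K := by
  obtain ⟨s, -, h, hinj, hintegral⟩ :=
    exists_integral_inj_algHom_of_quotient (RingHom.ker g) (RingHom.ker_ne_top _)
  have hs : s ≤ K := by
    have hind : AlgebraicIndependent ℂ
        fun i => ((Ideal.kerLiftAlg g).comp h) (MvPolynomial.X i : MvPolynomial (Fin s) ℂ) := by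
      have := (MvPolynomial.algebraicIndependent_X (Fin s) ℂ).map'
        (f := (Ideal.kerLiftAlg g).comp h) ((Ideal.kerLiftAlg_injective g).comp hinj)
      exact this
    have := hind.lift_cardinalMk_le_trdeg
    rw [MvPolynomial.trdeg_of_isDomain] at this
    simpa using this
  have hle : ringKrullDim (MvPolynomial (Fin D) ℂ ⧸ RingHom.ker g) ≤
      ringKrullDim (MvPolynomial (Fin s) ℂ) := by
    let _ : Algebra (MvPolynomial (Fin s) ℂ) (MvPolynomial (Fin D) ℂ ⧸ RingHom.ker g) :=
      h.toRingHom.toAlgebra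
    have : Algebra.IsIntegral (MvPolynomial (Fin s) ℂ)
      (MvPolynomial (Fin D) ℂ ⧸ RingHom.ker g) := ⟨hintegral⟩
    refine Order.krullDim_le_of_strictMono (PrimeSpectrum.comap (algebraMap _ _)) ?_
    intro x y hxy
    exact Ideal.IsIntegral.comap_lt_comap (I := x.asIdeal) (J := y.asIdeal) hxy
  refine hle.trans ?_
  rw [MvPolynomial.ringKrullDim_of_isNoetherianRing]
  simpa using hs

variable {P V : Type*} [AddCommGroup P] [Module ℂ P] [AddCommGroup V] [Module ℂ V]
  [FiniteDimensional ℂ P] [FiniteDimensional ℂ V]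

lemma zDimV_zClosureV_range_le {φ : P → V} (hφ : IsPolyMap φ) :
    zDimV (zClosureV (Set.range φ)) ≤ Module.finrank ℂ P := by
  let a := (Module.finBasis ℂ P).equivFun
  let b := (Module.finBasis ℂ V).equivFun
  obtain ⟨F, hF⟩ := exists_mvPolynomial_of_isPolyMap (φ := fun x => b (φ (a.symm x)))
    ((hφ.comp (IsPolyMap.linear a.symm.toLinearMap)).linear_comp b.toLinearMap)
  refine le_trans ?_ (ringKrullDim_quotient_ker_le (MvPolynomial.aeval F))
  rw [ringKrullDim_quotient, zDimV, topologicalKrullDim, ← Order.krullDim_orderDual]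
  set Z := zClosureV (Set.range φ)
  let _ := ztV V
  let vanishing : Set Z → Ideal (MvPolynomial (Fin (Module.finrank ℂ V)) ℂ) :=
    fun Y => ⨅ z ∈ Y, RingHom.ker (MvPolynomial.eval (b (z : V)))
  have hmem : ∀ Y q, q ∈ vanishing Y ↔ ∀ z ∈ Y, MvPolynomial.eval (b (z : V)) q = 0 := by
    intro Y q
    simp only [vanishing, Submodule.mem_iInf, RingHom.mem_ker]
  have hpoly : ∀ q : MvPolynomial (Fin (Module.finrank ℂ V)) ℂ,
      (fun y => MvPolynomial.eval (b y) q) ∈ polyFun V := fun q =>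
    mvPolynomial_eval_mem_polyFun q fun i => (LinearMap.proj i).comp b.toLinearMap
  have hopen : ∀ q : MvPolynomial (Fin (Module.finrank ℂ V)) ℂ,
      IsOpen {z : Z | MvPolynomial.eval (b (z : V)) q ≠ 0} := fun q =>
    (isOpen_polyFun_ne (hpoly q)).preimage continuous_subtype_val
  have hprime : ∀ Y : TopologicalSpace.IrreducibleCloseds Z, (vanishing Y).IsPrime := by
    intro Y
    refine ⟨?_, fun {q r} hqr => ?_⟩
    · obtain ⟨z, hz⟩ := Y.isIrreducible'.nonempty
      intro h
      have := (hmem Y 1).1 (h ▸ Submodule.mem_top) z hz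
      simp at this
    · simp only [hmem] at hqr ⊢
      by_contra! hcon
      obtain ⟨⟨z, hz, hzq⟩, ⟨w, hw, hwr⟩⟩ := hcon
      obtain ⟨v, hv, hvq, hvr⟩ :=
        Y.isIrreducible'.isPreirreducible _ _ (hopen q) (hopen r) ⟨z, hz, hzq⟩ ⟨w, hw, hwr⟩
      have := hqr v hv
      rw [map_mul] at this
      exact mul_ne_zero hvq hvr this
  have hker : ∀ Y, RingHom.ker (MvPolynomial.aeval F) ≤ vanishing Y := by
    intro Y q hq
    rw [hmem]
    intro z _
    refine mem_zClosureV_iff.1 z.2 _ (hpoly q) ?_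
    rintro _ ⟨x, rfl⟩
    have h1 : b (φ x) = fun j => MvPolynomial.eval (a x) (F j) := by
      ext j
      simpa using hF (a x) j
    rw [RingHom.mem_ker] at hq
    rw [h1, ← eval_aeval_eq, hq, map_zero]
  have hanti : ∀ Y Y' : TopologicalSpace.IrreducibleCloseds Z, Y' < Y →
      vanishing Y < vanishing Y' := by
    intro Y Y' hlt
    have hlt' : (Y' : Set Z) ⊂ Y := hlt
    refine lt_of_le_not_ge (fun q hq => (hmem _ _).2 fun z hz => (hmem _ _).1 hq z (hlt'.1 hz)) ?_
    intro hge
    refine hlt'.2 fun z hz => ?_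
    by_contra hzY
    obtain ⟨C, hC, hCY⟩ := isClosed_induced_iff.1 Y'.isClosed'
    replace hCY : ∀ w : Z, (w : V) ∈ C ↔ w ∈ (Y' : Set Z) := fun w => Set.ext_iff.1 hCY w
    obtain ⟨f, hf, hfz, hfC⟩ := exists_polyFun_of_isOpen (isOpen_compl_iff.2 hC) (x := (z : V))
      fun h => hzY ((hCY z).1 h)
    obtain ⟨q, hq⟩ := exists_mvPolynomial_of_mem_polyFun (Module.finBasis ℂ V) hf
    have hq' : ∀ x, f x = MvPolynomial.eval (b x) q := hq
    have hqY : q ∈ vanishing Y' := by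
      rw [hmem]
      intro w hw
      rw [← hq']
      by_contra hfw
      exact hfC _ hfw ((hCY w).2 hw)
    exact hfz (by rw [hq']; exact (hmem _ _).1 (hge hqY) z hz)
  let toPrime : TopologicalSpace.IrreducibleCloseds Z →
      PrimeSpectrum.zeroLocus (RingHom.ker (MvPolynomial.aeval (R := ℂ) F) :
        Set (MvPolynomial (Fin (Module.finrank ℂ V)) ℂ)) :=
    fun Y => ⟨⟨vanishing Y, hprime Y⟩, hker Y⟩
  refine Order.krullDim_le_of_strictMono (fun Y => toPrime (OrderDual.ofDual Y)) ?_
  exact fun Y Y' hlt => hanti (OrderDual.ofDual Y) (OrderDual.ofDual Y') hlt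

lemma finrank_le_zDimV_zClosureV_range {φ : P → V} (hφ : IsPolyMap φ) (p : P) (T : P →ₗ[ℂ] V)
    (hT : Function.Injective T)
    (hφT : ∀ v, HasLinearPart (fun t => φ (p + t • v)) (φ p) (T v)) :
    Module.finrank ℂ P ≤ zDimV (zClosureV (Set.range φ)) := by
  set K := Module.finrank ℂ P
  set Z := zClosureV (Set.range φ)
  let a := Module.finBasis ℂ P
  -- the flag of coordinate subspaces
  let A : (i : ℕ) → (hi : i ≤ K) → (Fin i → ℂ) →ₗ[ℂ] P := fun i hi =>
    Fintype.linearCombination ℂ fun j => a (Fin.castLE hi j)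
  have hA : ∀ i hi, Function.Injective (A i hi) := fun i hi =>
    (a.linearIndependent.comp _ (Fin.castLE_injective hi)).fintypeLinearCombination_injective
  have hAmono : ∀ i hi (x : Fin i → ℂ), ∃ y, A (i + 1) hi y = A i (by omega) x := by
    intro i hi x
    refine ⟨Fin.snoc x 0, ?_⟩
    simp [A, Fintype.linearCombination_apply, Fin.sum_univ_castSucc]
  let _ := ztV V
  let ψ : (i : ℕ) → (hi : i ≤ K) → (Fin i → ℂ) → Z := fun i hi x =>
    ⟨φ (p + A i hi x), subset_zClosureV _ ⟨_, rfl⟩⟩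
  have hψpoly : ∀ i hi, IsPolyMap fun x => (ψ i hi x : V) := fun i hi =>
    hφ.comp ((IsPolyMap.const p).add (IsPolyMap.linear (A i hi)))
  have hψirr : ∀ i hi, IsIrreducible (Set.range (ψ i hi)) := by
    intro i hi
    let _ := ztV (Fin i → ℂ)
    rw [← Set.image_univ]
    exact isIrreducible_univ_ztV.image _
      (Continuous.subtype_mk (hψpoly i hi).continuous_ztV _).continuousOn
  let Y : Fin (K + 1) → TopologicalSpace.IrreducibleCloseds Z := fun i =>
    ⟨closure (Set.range (ψ i (by omega))), (hψirr _ _).closure, isClosed_closure⟩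
  have hY : StrictMono Y := by
    rw [Fin.strictMono_iff_lt_succ]
    intro i
    have hi : (i : ℕ) + 1 ≤ K := i.2
    change closure (Set.range (ψ i (by omega))) ⊂ closure (Set.range (ψ (i + 1) hi))
    refine ⟨closure_mono ?_, fun hle => ?_⟩
    · rintro _ ⟨x, rfl⟩
      obtain ⟨y, hy⟩ := hAmono i hi x
      exact ⟨y, by simp [ψ, hy]⟩
    · obtain ⟨π, hπ⟩ := (T ∘ₗ A (i + 1) hi).exists_leftInverse_of_injective
        (LinearMap.ker_eq_bot.2 (hT.comp (hA _ _)))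
      obtain ⟨f, hf, hf0, hfφ⟩ := exists_polyFun_comp_eq_zero
        ((hψpoly i (by omega)).linear_comp π) (by simp)
      have hfπ := (IsPolyMap.linear π).polyFun_comp hf
      have hcl : IsClosed {z : Z | f (π z) = 0} :=
        (isClosed_polyFun_eq_zero hfπ).preimage continuous_subtype_val
      have hsub : closure (Set.range (ψ i (by omega))) ⊆ {z : Z | f (π z) = 0} :=
        closure_minimal (by rintro _ ⟨x, rfl⟩; exact hfφ x) hcl
      refine hf0 (polyFun_eq_zero_of_comp_eq_zero
        ((hψpoly (i + 1) hi).linear_comp π) 0 LinearMap.id Function.surjective_id ?_ hf ?_)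
      · intro v
        have := (hφT (A _ hi v)).linear_comp π
        have hv : π (T (A _ hi v)) = v := LinearMap.congr_fun hπ v
        simpa [ψ, hv] using this
      · intro x
        exact hsub (hle (subset_closure ⟨x, rfl⟩))
  exact Order.LTSeries.length_le_krullDim (LTSeries.mk K Y hY)

/-- The closure of the image of a polynomial map with injective derivative at some point has the
dimension of the source. -/
lemma zDimV_zClosureV_range_eq {φ : P → V} (hφ : IsPolyMap φ) (p : P) (T : P →ₗ[ℂ] V)
    (hT : Function.Injective T)
    (hφT : ∀ v, HasLinearPart (fun t => φ (p + t • v)) (φ p) (T v)) :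
    zDimV (zClosureV (Set.range φ)) = Module.finrank ℂ P :=
  le_antisymm (zDimV_zClosureV_range_le hφ) (finrank_le_zDimV_zClosureV_range hφ p T hT hφT)

end Dimension

section LinearPart

variable {E A : Type*} [AddCommGroup E] [Module ℂ E] [CommRing A] [Algebra ℂ A]

namespace HasLinearPart

lemma const (a : E) : HasLinearPart (fun _ => a) a 0 :=
  ⟨fun _ => 0, IsPolyMap.const 0, by simp⟩

lemma line (a v : E) : HasLinearPart (fun t => a + t • v) a v :=
  ⟨fun _ => 0, IsPolyMap.const 0, by simp⟩

lemma const_smul {f : ℂ → E} {a a' : E} (h : HasLinearPart f a a') (c : ℂ) :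
    HasLinearPart (fun t => c • f t) (c • a) (c • a') := by
  exact h.linear_comp (c • LinearMap.id)

lemma add {f g : ℂ → E} {a a' b b' : E} (hf : HasLinearPart f a a') (hg : HasLinearPart g b b') :
    HasLinearPart (fun t => f t + g t) (a + b) (a' + b') := by
  obtain ⟨ψ, hψ, hf⟩ := hf
  obtain ⟨χ, hχ, hg⟩ := hg
  refine ⟨_, hψ.add hχ, fun t => ?_⟩
  simp only [hf, hg]
  module

lemma sum {ι : Type*} (s : Finset ι) {f : ι → ℂ → E} {a a' : ι → E}
    (h : ∀ i ∈ s, HasLinearPart (f i) (a i) (a' i)) :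
    HasLinearPart (fun t => ∑ i ∈ s, f i t) (∑ i ∈ s, a i) (∑ i ∈ s, a' i) := by
  classical
  induction s using Finset.induction_on with
  | empty => simpa using const (0 : E)
  | insert i s hi ih =>
    simp only [Finset.sum_insert hi]
    exact (h i (by simp)).add (ih fun j hj => h j (by simp [hj]))

lemma mul {f g : ℂ → A} {a a' b b' : A} (hf : HasLinearPart f a a')
    (hg : HasLinearPart g b b') :
    HasLinearPart (fun t => f t * g t) (a * b) (a' * b + a * b') := by
  obtain ⟨ψ, hψ, hf⟩ := hf
  obtain ⟨χ, hχ, hg⟩ := hg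
  have ht : IsPolyMap fun t : ℂ => algebraMap ℂ A t :=
    (IsPolyMap.linear LinearMap.id).linear_comp (Algebra.linearMap ℂ A)
  refine ⟨fun t => a' * b' + a * χ t + ψ t * b + algebraMap ℂ A t * (a' * χ t + ψ t * b') +
    algebraMap ℂ A t ^ 2 * (ψ t * χ t), ?_, fun t => ?_⟩
  · exact (((((IsPolyMap.const _).add ((IsPolyMap.const a).mul hχ)).add
      (hψ.mul (IsPolyMap.const b)))).add (ht.mul (((IsPolyMap.const a').mul hχ).add
      (hψ.mul (IsPolyMap.const b'))))).add ((ht.pow 2).mul (hψ.mul hχ))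
  · simp only [hf, hg, Algebra.smul_def, map_pow]
    ring

lemma codRestrict {S : Submodule ℂ E} {f : ℂ → S} {a a' : S}
    (h : HasLinearPart (fun t => (f t : E)) a a') : HasLinearPart f a a' := by
  obtain ⟨T, hT⟩ := S.subtype.exists_leftInverse_of_injective (by simp)
  have hT' : ∀ x : S, T x = x := LinearMap.congr_fun hT
  simpa [hT'] using h.linear_comp T

end HasLinearPart

end LinearPart

section SecantsOfParametrized

lemma secantV_range {P V : Type*} [AddCommGroup V] [Module ℂ V] (s : P → V) (m : ℕ) :
    secantV m (Set.range s) =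
    zClosureV (Set.range fun p : Fin m → P => ∑ i, s (p i)) := by
  unfold secantV
  congr 1
  ext x
  constructor
  · rintro ⟨y, hy, rfl⟩
    choose p hp using hy
    exact ⟨p, by simp [hp]⟩
  · rintro ⟨p, rfl⟩
    exact ⟨fun i => s (p i), fun i => ⟨_, rfl⟩, rfl⟩

variable {P V : Type*} [AddCommGroup P] [Module ℂ P] [AddCommGroup V] [Module ℂ V]
  {L : P → P →ₗ[ℂ] V} {s : P → V}

/-- The derivative of the addition map `(p₁, …, p_m) ↦ s p₁ + ⋯ + s p_m`. -/
def sumDeriv (L : P → P →ₗ[ℂ] V) {m : ℕ} (p : Fin m → P) : (Fin m → P) →ₗ[ℂ] V :=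
  ∑ i, L (p i) ∘ₗ LinearMap.proj i

lemma range_sumDeriv {m : ℕ} (p : Fin m → P) :
    LinearMap.range (sumDeriv L p) = imageSum L p Finset.univ := by
  ext w
  rw [mem_imageSum_iff]
  simp [sumDeriv, eq_comm]

lemma hasLinearPart_sum (hs : ∀ p v, HasLinearPart (fun t => s (p + t • v)) (s p) (L p v)) {m : ℕ}
    (p v : Fin m → P) : HasLinearPart (fun t => ∑ i, s ((p + t • v) i)) (∑ i, s (p i))
      (sumDeriv L p v) := by
  have := HasLinearPart.sum Finset.univ fun i _ => hs (p i) (v i)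
  simpa [sumDeriv] using this

variable [FiniteDimensional ℂ P]

lemma isPolyMap_sum (hs : IsPolyMap s) (m : ℕ) :
    IsPolyMap fun p : Fin m → P => ∑ i, s (p i) :=
  IsPolyMap.sum _ fun i _ => hs.comp (IsPolyMap.linear (LinearMap.proj (R := ℂ) (φ := fun _ => P) i))

variable [FiniteDimensional ℂ V]

lemma zDimV_secantV_range (hs : IsPolyMap s)
    (hL : ∀ p v, HasLinearPart (fun t => s (p + t • v)) (s p) (L p v)) {m : ℕ}
    (h : maxRank L m = m * Module.finrank ℂ P) :
    zDimV (secantV m (Set.range s)) = (m * Module.finrank ℂ P : ℕ) := by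
  obtain ⟨p, hp⟩ := exists_finrank_imageSum_eq L m
  have hinj : Function.Injective (sumDeriv L p) := by
    have := LinearMap.finrank_range_add_finrank_ker (sumDeriv L p)
    rw [range_sumDeriv, hp, h, Module.finrank_pi_fintype] at this
    simp only [Finset.sum_const, Finset.card_univ, Fintype.card_fin, smul_eq_mul] at this
    exact LinearMap.ker_eq_bot.1 (Submodule.finrank_eq_zero.1 (by omega))
  rw [secantV_range, zDimV_zClosureV_range_eq (isPolyMap_sum hs m) p (sumDeriv L p) hinj
    fun v => hasLinearPart_sum hL p v, Module.finrank_pi_fintype]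
  simp

lemma secantV_range_eq_univ (hs : IsPolyMap s)
    (hL : ∀ p v, HasLinearPart (fun t => s (p + t • v)) (s p) (L p v)) {m : ℕ}
    (h : maxRank L m = Module.finrank ℂ V) : secantV m (Set.range s) = Set.univ := by
  obtain ⟨p, hp⟩ := exists_finrank_imageSum_eq L m
  rw [secantV_range]
  refine zClosureV_range_eq_univ (isPolyMap_sum hs m) p (sumDeriv L p) ?_
    fun v => hasLinearPart_sum hL p v
  rw [← LinearMap.range_eq_top, range_sumDeriv]
  exact Submodule.eq_top_of_finrank_eq (hp.trans h)

lemma zDimV_zClosureV_range (hs : IsPolyMap s)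
    (hL : ∀ p v, HasLinearPart (fun t => s (p + t • v)) (s p) (L p v))
    {p : P} (hp : Function.Injective (L p)) :
    zDimV (zClosureV (Set.range s)) = Module.finrank ℂ P :=
  zDimV_zClosureV_range_eq hs p (L p) hp (hL p)

lemma maxRank_one_eq_finrank {p : P} (hp : Function.Injective (L p)) :
    maxRank L 1 = Module.finrank ℂ P := by
  refine le_antisymm ?_ ?_
  · obtain ⟨p', hp'⟩ := exists_finrank_imageSum_eq L 1
    rw [← hp', ← range_sumDeriv]
    simpa [Module.finrank_pi_fintype] using LinearMap.finrank_range_le (sumDeriv L p')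
  · have := finrank_imageSum_le_maxRank (L := L) (fun _ : Unit => p) {()}
    rw [show imageSum L (fun _ : Unit => p) {()} = LinearMap.range (L p) by simp [imageSum],
      LinearMap.finrank_range_of_inj hp] at this
    simpa using this

/-- For a parametrized variety whose tangent spaces are permuted by an irreducible family of
linear maps, all secant varieties of sufficiently small or sufficiently large order have the
expected dimension. -/
theorem secantV_range_nondefective (hs : IsPolyMap s)
    (hLpoly : ∀ u, IsPolyMap fun p => L p u)
    (hL : ∀ p v, HasLinearPart (fun t => s (p + t • v)) (s p) (L p v))
    {p₀ : P} (hp₀ : Function.Injective (L p₀)) (hP : 0 < Module.finrank ℂ P)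
    {M : Type*} [AddCommGroup M] [Module ℂ M] (aP : M → P → P) (aV : M → V →ₗ[ℂ] V) (e : M)
    (haP : ∀ g p, IsPolyMap fun t : ℂ => aP (e + t • g) p)
    (haV : ∀ g v, IsPolyMap fun t : ℂ => aV (e + t • g) v)
    (heP : ∀ p, aP e p = p)
    (hequi : ∀ g p u, aV g (L p u) ∈ LinearMap.range (L (aP g p)))
    (hirr : ∀ v ≠ 0, ∀ W : Submodule ℂ V, (∀ g, aV g v ∈ W) → W = ⊤) (m : ℕ) :
    (Module.finrank ℂ P * (m + Module.finrank ℂ P) ≤ Module.finrank ℂ V →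
      zDimV (secantV m (Set.range s)) = (m * Module.finrank ℂ P : ℕ)) ∧
    (Module.finrank ℂ V + Module.finrank ℂ P ^ 2 ≤ m * Module.finrank ℂ P →
      secantV m (Set.range s) = Set.univ) := by
  have h1 := maxRank_one_eq_finrank hp₀
  have hmono := maxRank_le_succ hLpoly
  have hconc := maxRank_concave hLpoly
  obtain ⟨k, hk, hkD⟩ := exists_linear_and_eq_bound hP (maxRank_zero L) h1 hmono
    (maxRank_le_finrank L) hconc fun k hr hlt =>
      maxRank_eq_finrank_of_increments_eq hLpoly aP aV e haP haV heP hequi hirr hr (by rwa [h1])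
  set N := Module.finrank ℂ P
  set D := Module.finrank ℂ V
  have hle : ∀ j, maxRank L j ≤ j * N := by
    intro j
    obtain ⟨p, hp⟩ := exists_finrank_imageSum_eq L j
    rw [← hp, ← range_sumDeriv]
    simpa [Module.finrank_pi_fintype] using LinearMap.finrank_range_le (sumDeriv L p)
  refine ⟨fun h => zDimV_secantV_range hs hL (hk m ?_),
    fun h => secantV_range_eq_univ hs hL (le_antisymm (maxRank_le_finrank L m) ?_)⟩
  · by_contra! hkm
    have := hle (k + N)
    rw [hkD] at this
    nlinarith
  · rcases le_or_gt (k + N) m with hm | hm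
    · exact hkD.symm.le.trans (monotone_nat_of_le_succ hmono hm)
    · have h2 := maxRank_le_finrank L k
      rw [hk k le_rfl] at h2
      nlinarith

end SecantsOfParametrized

section HomogeneousPolynomials

variable {n : ℕ}

lemma homogeneousSubmodule_eq_span_monomial (n d : ℕ) : homogeneousSubmodule (Fin n) ℂ d =
    Submodule.span ℂ (Set.range fun s : (Finset.univ : Finset (Fin n)).finsuppAntidiag d =>
      monomial (s : Fin n →₀ ℕ) (1 : ℂ)) := by
  rw [homogeneousSubmodule_eq_finsupp_supported, AddMonoidAlgebra.supported_eq_span_single]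
  congr 1
  ext p
  simp only [Set.mem_image, Set.mem_ofPred_eq, Set.mem_range, Subtype.exists,
    Finset.mem_finsuppAntidiag, Finset.subset_univ, and_true, Finsupp.degree_eq_sum,
    exists_prop]
  rfl

lemma linearIndependent_monomial_finsuppAntidiag (n d : ℕ) : LinearIndependent ℂ
    fun s : (Finset.univ : Finset (Fin n)).finsuppAntidiag d =>
      monomial (s : Fin n →₀ ℕ) (1 : ℂ) := by
  have := (basisMonomials (Fin n) ℂ).linearIndependent.comp
    (fun s : (Finset.univ : Finset (Fin n)).finsuppAntidiag d => (s : Fin n →₀ ℕ))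
    Subtype.val_injective
  simpa [Function.comp_def] using this

lemma finrank_homogeneousSubmodule (n d : ℕ) :
    Module.finrank ℂ (homogeneousSubmodule (Fin n) ℂ d) = (n + d - 1).choose d := by
  rw [homogeneousSubmodule_eq_span_monomial,
    finrank_span_eq_card (linearIndependent_monomial_finsuppAntidiag n d), Fintype.card_coe,
    Finset.card_finsuppAntidiag_nat_eq_choose]
  simp

instance finiteDimensional_homogeneousSubmodule (n d : ℕ) :
    FiniteDimensional ℂ (homogeneousSubmodule (Fin n) ℂ d) := by
  rw [homogeneousSubmodule_eq_span_monomial]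
  exact FiniteDimensional.span_of_finite ℂ (Set.finite_range _)

lemma isHomogeneous_sum_smul_X (c : Fin n → ℂ) :
    (∑ j, c j • X j : MvPolynomial (Fin n) ℂ).IsHomogeneous 1 :=
  Submodule.sum_mem (homogeneousSubmodule (Fin n) ℂ 1) fun j _ =>
    Submodule.smul_mem _ _ (isHomogeneous_X ℂ j)

/-- A linear functional vanishing on all `d`-th powers of linear forms vanishes on all forms of
degree `d`. -/
lemma eq_zero_of_forall_pow_eq_zero {d : ℕ} (l : MvPolynomial (Fin n) ℂ →ₗ[ℂ] ℂ)
    (h : ∀ c : Fin n → ℂ, l ((∑ j, c j • X j) ^ d) = 0) {f : MvPolynomial (Fin n) ℂ}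
    (hf : f ∈ homogeneousSubmodule (Fin n) ℂ d) : l f = 0 := by
  let Q : MvPolynomial (Fin n) ℂ := ∑ k ∈ Finset.piAntidiag Finset.univ d,
    C (Nat.multinomial Finset.univ k * l (∏ i, X i ^ k i)) * ∏ i, X i ^ k i
  have hQ : Q = 0 := by
    refine MvPolynomial.funext fun c => ?_
    have := h c
    rw [Finset.sum_pow_eq_sum_piAntidiag, map_sum] at this
    rw [map_zero, ← this]
    simp only [Q, map_sum, map_mul, eval_C, map_prod, map_pow, eval_X]
    refine Finset.sum_congr rfl fun k _ => ?_
    simp only [smul_pow, Finset.prod_smul, ← nsmul_eq_mul, map_nsmul, map_smul, smul_eq_mul]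
    ring
  rw [homogeneousSubmodule_eq_span_monomial] at hf
  suffices hle : Submodule.span ℂ (Set.range
      fun s : (Finset.univ : Finset (Fin n)).finsuppAntidiag d =>
        monomial (s : Fin n →₀ ℕ) (1 : ℂ)) ≤ LinearMap.ker l from hle hf
  rw [Submodule.span_le]
  rintro _ ⟨⟨s, hs⟩, rfl⟩
  have hmon : (monomial s (1 : ℂ)) = ∏ i, X i ^ s i := by
    rw [monomial_eq, C_1, one_mul, Finsupp.prod_fintype _ _ (by simp)]
  have hs' : (⇑s) ∈ Finset.piAntidiag Finset.univ d := by
    simpa using (Finset.mem_finsuppAntidiag.1 hs).1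
  have hcoeff := congrArg (coeff s) hQ
  simp only [Q, coeff_sum, coeff_C_mul, coeff_zero] at hcoeff
  rw [Finset.sum_eq_single_of_mem _ hs'] at hcoeff
  · rw [← hmon, coeff_monomial, if_pos rfl, mul_one] at hcoeff
    exact (mul_eq_zero.1 hcoeff).resolve_left
      (Nat.cast_ne_zero.2 (Nat.multinomial_pos _ _).ne')
  · intro k _ hk
    have : (∏ i, X i ^ k i : MvPolynomial (Fin n) ℂ) =
        monomial (Finsupp.equivFunOnFinite.symm k) 1 := by
      rw [monomial_eq, C_1, one_mul, Finsupp.prod_fintype _ _ (by simp)]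
      rfl
    rw [this, coeff_monomial, if_neg, mul_zero]
    rintro rfl
    exact hk rfl

/-- The substitution `X i ↦ ∑ j, M i j • X j`. -/
def substMatrix (M : Matrix (Fin n) (Fin n) ℂ) :
    MvPolynomial (Fin n) ℂ →ₐ[ℂ] MvPolynomial (Fin n) ℂ :=
  aeval fun i => ∑ j, M i j • X j

lemma substMatrix_one (p : MvPolynomial (Fin n) ℂ) : substMatrix 1 p = p := by
  have : (fun i : Fin n => ∑ j, (1 : Matrix (Fin n) (Fin n) ℂ) i j • X j) =
      (X : Fin n → MvPolynomial (Fin n) ℂ) := by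
    ext1 i
    simp [Matrix.one_apply, ite_smul]
  rw [substMatrix, this, aeval_X_left_apply]

lemma substMatrix_mem {d : ℕ} (M : Matrix (Fin n) (Fin n) ℂ) {p : MvPolynomial (Fin n) ℂ}
    (hp : p ∈ homogeneousSubmodule (Fin n) ℂ d) :
    substMatrix M p ∈ homogeneousSubmodule (Fin n) ℂ d := by
  have := IsHomogeneous.aeval ((mem_homogeneousSubmodule _ _).1 hp) (fun i => ∑ j, M i j • X j)
    fun i => isHomogeneous_sum_smul_X (M i)
  rwa [one_mul] at this

lemma isPolyMap_substMatrix (M N : Matrix (Fin n) (Fin n) ℂ) (p : MvPolynomial (Fin n) ℂ) :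
    IsPolyMap fun t : ℂ => substMatrix (M + t • N) p := by
  induction p using MvPolynomial.induction_on with
  | C a => simpa [substMatrix] using IsPolyMap.const (P := ℂ) (C a : MvPolynomial (Fin n) ℂ)
  | add p q hp hq => simpa using hp.add hq
  | mul_X p i hp =>
    simp only [map_mul]
    refine hp.mul ?_
    simp only [substMatrix, aeval_X]
    refine IsPolyMap.sum _ fun j _ => polyFun_smul_isPolyMap ?_ _
    exact (IsPolyMap.line (M i j) (N i j)).mem_polyFun

lemma substMatrix_vecMulVec {d : ℕ} (a c : Fin n → ℂ) {p : MvPolynomial (Fin n) ℂ}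
    (hp : p ∈ homogeneousSubmodule (Fin n) ℂ d) :
    substMatrix (Matrix.vecMulVec a c) p = eval a p • (∑ j, c j • X j) ^ d := by
  have hvec : (fun i => ∑ j, Matrix.vecMulVec a c i j • X j) =
      fun i => a i • (∑ j, c j • X j : MvPolynomial (Fin n) ℂ) := by
    ext1 i
    simp [Matrix.vecMulVec_apply, Finset.smul_sum, smul_smul]
  rw [substMatrix, hvec, aeval_def, eval₂_eq', eval_eq', Finset.sum_smul]
  refine Finset.sum_congr rfl fun s hs => ?_
  have hdeg : ∑ i, s i = d := by
    have := (mem_homogeneousSubmodule _ _).1 hp (mem_support_iff.1 hs)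
    rw [← this, ← Finsupp.degree_eq_sum, Finsupp.degree_eq_weight_one]
    rfl
  simp only [smul_pow, Finset.prod_smul, Finset.prod_pow_eq_pow_sum, hdeg,
    ← Algebra.smul_def, smul_smul]

/-- The space of forms of degree `d` is irreducible under linear substitutions. -/
lemma eq_top_of_substMatrix_mem {d : ℕ} {v : MvPolynomial (Fin n) ℂ} (hv0 : v ≠ 0)
    (hv : v ∈ homogeneousSubmodule (Fin n) ℂ d)
    (W : Submodule ℂ (homogeneousSubmodule (Fin n) ℂ d))
    (hW : ∀ M, (⟨substMatrix M v, substMatrix_mem M hv⟩ : homogeneousSubmodule (Fin n) ℂ d) ∈ W) :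
    W = ⊤ := by
  by_contra hne
  obtain ⟨w, hw⟩ : ∃ w, w ∉ W := by
    by_contra! h
    exact hne (Submodule.eq_top_iff'.2 h)
  obtain ⟨l, hlw, hlW⟩ := Submodule.exists_le_ker_of_notMem hw
  obtain ⟨l', hl'⟩ := l.exists_extend
  obtain ⟨a, ha⟩ : ∃ a, eval a v ≠ 0 := by
    by_contra! h
    exact hv0 (MvPolynomial.funext fun a => by rw [h a, map_zero])
  refine hlw ?_
  have hll : ∀ f : homogeneousSubmodule (Fin n) ℂ d, l f = l' f :=
    fun f => (LinearMap.congr_fun hl' f).symm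
  rw [hll]
  refine eq_zero_of_forall_pow_eq_zero l' (fun c => ?_) w.2
  have h1 : l ⟨_, substMatrix_mem (Matrix.vecMulVec a c) hv⟩ = 0 := hlW (hW _)
  rw [hll] at h1
  change l' (substMatrix _ v) = 0 at h1
  rw [substMatrix_vecMulVec a c hv, map_smul, smul_eq_mul] at h1
  exact (mul_eq_zero.1 h1).resolve_left ha

end HomogeneousPolynomials

section Moments

variable {n : ℕ}

/-- The summands of `sMoment`, extended by zero. -/
def sMomentTerm (d : ℕ) (ℓ q : MvPolynomial (Fin n) ℂ) (j : ℕ) : MvPolynomial (Fin n) ℂ :=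
  if 2 * j ≤ d then
    ((1 : ℂ) / ((2 ^ j * Nat.factorial j * Nat.factorial (d - 2 * j) : ℕ) : ℂ)) •
      (ℓ ^ (d - 2 * j) * q ^ j)
  else 0

lemma sMoment_eq_sum_term {d M : ℕ} (h : d / 2 + 1 ≤ M) (ℓ q : MvPolynomial (Fin n) ℂ) :
    sMoment n d ℓ q = ∑ j ∈ Finset.range M, sMomentTerm d ℓ q j := by
  rw [← Finset.sum_subset (Finset.range_subset_range.2 h)]
  · refine Finset.sum_congr rfl fun j hj => ?_
    have := Finset.mem_range.1 hj
    rw [sMomentTerm, if_pos (by omega)]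
  · intro j _ hj
    rw [Finset.mem_range] at hj
    rw [sMomentTerm, if_neg (by omega)]

lemma sMomentTerm_zero (e : ℕ) (ℓ q : MvPolynomial (Fin n) ℂ) :
    ((e + 2 : ℕ) : ℂ) • sMomentTerm (e + 2) ℓ q 0 = ℓ * sMomentTerm (e + 1) ℓ q 0 := by
  simp only [sMomentTerm, mul_zero, Nat.zero_le, if_true, Nat.sub_zero, pow_zero, mul_one, one_mul,
    Nat.factorial_zero, mul_smul_comm, smul_smul, ← pow_succ']
  congr 1
  rw [Nat.factorial_succ (e + 1)]
  have := Nat.factorial_ne_zero (e + 1)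
  have h2 : (e : ℂ) + 1 + 1 ≠ 0 := by exact_mod_cast (e + 1).succ_ne_zero
  push_cast
  field_simp
  ring

lemma sMomentTerm_succ (e j : ℕ) (ℓ q : MvPolynomial (Fin n) ℂ) :
    ((e + 2 : ℕ) : ℂ) • sMomentTerm (e + 2) ℓ q (j + 1) =
      ℓ * sMomentTerm (e + 1) ℓ q (j + 1) + q * sMomentTerm e ℓ q j := by
  have h2 : (2 : ℂ) ≠ 0 := two_ne_zero
  have hj := Nat.factorial_ne_zero j
  rcases lt_trichotomy e (2 * j) with h | rfl | h
  · rw [sMomentTerm, sMomentTerm, sMomentTerm, if_neg (by omega), if_neg (by omega),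
      if_neg (by omega)]
    simp
  · rw [sMomentTerm, sMomentTerm, sMomentTerm, if_pos (by omega), if_neg (by omega),
      if_pos (by omega), mul_zero, zero_add, mul_smul_comm, smul_smul,
      show 2 * j + 2 - 2 * (j + 1) = 0 by omega, Nat.sub_self, Nat.factorial_succ j, pow_succ q]
    rw [show q * (ℓ ^ 0 * q ^ j) = ℓ ^ 0 * (q ^ j * q) by ring]
    congr 1
    have : (j : ℂ) + 1 ≠ 0 := Nat.cast_add_one_ne_zero j
    push_cast
    field_simp
    ring
  · obtain ⟨r, rfl⟩ := Nat.exists_eq_add_of_lt h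
    rw [sMomentTerm, sMomentTerm, sMomentTerm, if_pos (by omega), if_pos (by omega),
      if_pos (by omega), show 2 * j + r + 1 + 2 - 2 * (j + 1) = r + 1 by omega,
      show 2 * j + r + 1 + 1 - 2 * (j + 1) = r by omega,
      show 2 * j + r + 1 - 2 * j = r + 1 by omega, mul_smul_comm, mul_smul_comm, smul_smul,
      show ℓ * (ℓ ^ r * q ^ (j + 1)) = ℓ ^ (r + 1) * q ^ (j + 1) by ring,
      show q * (ℓ ^ (r + 1) * q ^ j) = ℓ ^ (r + 1) * q ^ (j + 1) by ring, ← add_smul,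
      Nat.factorial_succ j, Nat.factorial_succ r]
    congr 1
    have h3 : (j : ℂ) + 1 ≠ 0 := Nat.cast_add_one_ne_zero j
    have h4 : (r : ℂ) + 1 ≠ 0 := Nat.cast_add_one_ne_zero r
    have h5 := Nat.factorial_ne_zero r
    push_cast
    field_simp
    ring

/-- The recurrence obtained by applying the Euler operator to `exp (ℓ + q / 2)`. -/
lemma sMoment_recurrence (e : ℕ) (ℓ q : MvPolynomial (Fin n) ℂ) :
    ((e + 2 : ℕ) : ℂ) • sMoment n (e + 2) ℓ q =
      ℓ * sMoment n (e + 1) ℓ q + q * sMoment n e ℓ q := by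
  rw [sMoment_eq_sum_term (M := e + 3) (by omega), sMoment_eq_sum_term (M := e + 3) (by omega),
    sMoment_eq_sum_term (M := e + 2) (by omega), Finset.sum_range_succ' _ (e + 2),
    Finset.sum_range_succ' _ (e + 2), smul_add, Finset.smul_sum, mul_add, Finset.mul_sum,
    Finset.mul_sum, sMomentTerm_zero, Finset.sum_congr rfl fun j _ => sMomentTerm_succ e j ℓ q,
    Finset.sum_add_distrib]
  ring

@[simp]
lemma sMoment_zero (ℓ q : MvPolynomial (Fin n) ℂ) : sMoment n 0 ℓ q = 1 := by
  simp [sMoment]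

@[simp]
lemma sMoment_one (ℓ q : MvPolynomial (Fin n) ℂ) : sMoment n 1 ℓ q = ℓ := by
  simp [sMoment]

lemma sMoment_add_two (e : ℕ) (ℓ q : MvPolynomial (Fin n) ℂ) :
    sMoment n (e + 2) ℓ q = ((e + 2 : ℕ) : ℂ)⁻¹ •
      (ℓ * sMoment n (e + 1) ℓ q + q * sMoment n e ℓ q) := by
  rw [← sMoment_recurrence, smul_smul, inv_mul_cancel₀ (Nat.cast_ne_zero.2 (by omega)), one_smul]

lemma sMoment_mem {d : ℕ} {ℓ q : MvPolynomial (Fin n) ℂ}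
    (hℓ : ℓ ∈ homogeneousSubmodule (Fin n) ℂ 1) (hq : q ∈ homogeneousSubmodule (Fin n) ℂ 2) :
    sMoment n d ℓ q ∈ homogeneousSubmodule (Fin n) ℂ d := by
  induction d using Nat.twoStepInduction with
  | zero => rw [sMoment_zero]; exact isHomogeneous_one (Fin n) ℂ
  | one => simpa using hℓ
  | more e h0 h1 =>
    rw [sMoment_add_two]
    refine Submodule.smul_mem _ _ (Submodule.add_mem _ ?_ ?_)
    · have := IsHomogeneous.mul hℓ h1
      rwa [show 1 + (e + 1) = e + 2 by ring] at this
    · have := IsHomogeneous.mul hq h0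
      rwa [show 2 + e = e + 2 by ring] at this

lemma isPolyMap_sMoment {P : Type*} [AddCommGroup P] [Module ℂ P]
    {ℓ q : P → MvPolynomial (Fin n) ℂ} (hℓ : IsPolyMap ℓ) (hq : IsPolyMap q) (d : ℕ) :
    IsPolyMap fun p => sMoment n d (ℓ p) (q p) :=
  IsPolyMap.sum _ fun _ _ => ((hℓ.pow _).mul (hq.pow _)).const_smul _

lemma substMatrix_sMoment (M : Matrix (Fin n) (Fin n) ℂ) (d : ℕ) (ℓ q : MvPolynomial (Fin n) ℂ) :
    substMatrix M (sMoment n d ℓ q) = sMoment n d (substMatrix M ℓ) (substMatrix M q) := by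
  simp [sMoment]

/-- The differential of `(ℓ, q) ↦ s_{e+2}(ℓ, q)`. -/
lemma hasLinearPart_sMoment (e : ℕ) (ℓ q h k : MvPolynomial (Fin n) ℂ) :
    HasLinearPart (fun t : ℂ => sMoment n (e + 2) (ℓ + t • h) (q + t • k))
      (sMoment n (e + 2) ℓ q)
      (h * sMoment n (e + 1) ℓ q + (2⁻¹ : ℂ) • (k * sMoment n e ℓ q)) := by
  have hℓ := HasLinearPart.line ℓ h
  have hq := HasLinearPart.line q k
  have hC : 2 * C (2⁻¹ : ℂ) = (1 : MvPolynomial (Fin n) ℂ) := by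
    rw [← map_ofNat C 2, ← C_mul, mul_inv_cancel₀ two_ne_zero, C_1]
  have hone : HasLinearPart (fun t : ℂ => sMoment n 1 (ℓ + t • h) (q + t • k))
      (sMoment n 1 ℓ q) h := by
    simpa only [sMoment_one] using hℓ
  have hzero : HasLinearPart (fun t : ℂ => sMoment n 0 (ℓ + t • h) (q + t • k))
      (sMoment n 0 ℓ q) 0 := by
    simpa only [sMoment_zero] using HasLinearPart.const (1 : MvPolynomial (Fin n) ℂ)
  have step : ∀ (e : ℕ) (a b c : MvPolynomial (Fin n) ℂ),
      HasLinearPart (fun t : ℂ => sMoment n e (ℓ + t • h) (q + t • k)) (sMoment n e ℓ q) a →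
      HasLinearPart (fun t : ℂ => sMoment n (e + 1) (ℓ + t • h) (q + t • k))
        (sMoment n (e + 1) ℓ q) b →
      ((e + 2 : ℕ) : MvPolynomial (Fin n) ℂ) * c = h * sMoment n (e + 1) ℓ q + ℓ * b +
        (k * sMoment n e ℓ q + q * a) →
      HasLinearPart (fun t : ℂ => sMoment n (e + 2) (ℓ + t • h) (q + t • k))
        (sMoment n (e + 2) ℓ q) c := by
    intro e a b c ha hb hc
    have hc' : c = ((e + 2 : ℕ) : ℂ)⁻¹ • (h * sMoment n (e + 1) ℓ q + ℓ * b +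
        (k * sMoment n e ℓ q + q * a)) := by
      rw [eq_inv_smul_iff₀ (Nat.cast_ne_zero.2 (by omega)), ← hc, smul_eq_C_mul, map_natCast]
    rw [hc']
    simp only [sMoment_add_two e]
    exact ((hℓ.mul hb).add (hq.mul ha)).const_smul _
  have rec' : ∀ e : ℕ, ((e + 2 : ℕ) : MvPolynomial (Fin n) ℂ) * sMoment n (e + 2) ℓ q =
      ℓ * sMoment n (e + 1) ℓ q + q * sMoment n e ℓ q := fun e => by
    rw [← sMoment_recurrence, smul_eq_C_mul, map_natCast]
  induction e using Nat.twoStepInduction with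
  | zero =>
    refine step 0 0 h _ hzero hone ?_
    simp only [zero_add, sMoment_one, sMoment_zero, smul_eq_C_mul]
    push_cast
    linear_combination k * hC
  | one =>
    have htwo : HasLinearPart (fun t : ℂ => sMoment n 2 (ℓ + t • h) (q + t • k))
        (sMoment n 2 ℓ q) (h * ℓ + C 2⁻¹ * k) := by
      refine step 0 0 h _ hzero hone ?_
      simp only [zero_add, sMoment_one, sMoment_zero]
      push_cast
      linear_combination k * hC
    refine step 1 h _ _ hone htwo ?_
    have h2 := rec' 0
    simp only [zero_add, one_add_one_eq_two, sMoment_one, sMoment_zero, smul_eq_C_mul] at h2 ⊢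
    push_cast at h2 ⊢
    linear_combination h * h2 + ℓ * k * hC
  | more e h0 h1 =>
    refine step (e + 2) _ _ _ h0 h1 ?_
    have h2 := rec' e
    have h3 := rec' (e + 1)
    simp only [smul_eq_C_mul]
    push_cast at h2 h3 ⊢
    linear_combination h * h3 + C 2⁻¹ * k * h2 + k * sMoment n (e + 2) ℓ q * hC

end Moments

section Injectivity

variable {n : ℕ}

lemma eval_sMoment_ne_zero {i j : Fin n} (hij : i ≠ j) (e : ℕ) :
    eval (Pi.single i (1 : ℂ)) (sMoment n e (X i) (X j ^ 2)) ≠ 0 := by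
  induction e using Nat.twoStepInduction with
  | zero => simp
  | one => simp
  | more e _ h1 =>
    rw [sMoment_add_two, smul_eval]
    refine mul_ne_zero (inv_ne_zero (Nat.cast_ne_zero.2 (by omega))) ?_
    simpa [hij.symm] using h1

lemma sMoment_ne_zero {i j : Fin n} (hij : i ≠ j) (e : ℕ) : sMoment n e (X i) (X j ^ 2) ≠ 0 :=
  fun h => eval_sMoment_ne_zero hij e (by rw [h, map_zero])

lemma sMoment_dvd_of_syzygy {i j : Fin n} (hij : i ≠ j) (e : ℕ) (h k : MvPolynomial (Fin n) ℂ)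
    (H : h * sMoment n (e + 1) (X i) (X j ^ 2) + k * sMoment n e (X i) (X j ^ 2) = 0) :
    sMoment n e (X i) (X j ^ 2) ∣ h := by
  induction e generalizing h k with
  | zero => simp
  | succ e ih =>
    have hrec := sMoment_recurrence e (X i : MvPolynomial (Fin n) ℂ) (X j ^ 2)
    rw [smul_eq_C_mul, map_natCast] at hrec
    obtain ⟨w, hw⟩ := ih (h * X i + ((e + 2 : ℕ) : MvPolynomial (Fin n) ℂ) * k) (h * X j ^ 2)
      (by linear_combination ((e + 2 : ℕ) : MvPolynomial (Fin n) ℂ) * H - h * hrec)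
    have hw' : sMoment n (e + 1) (X i) (X j ^ 2) * w = - (X j ^ 2 * h) := by
      refine mul_left_cancel₀ (sMoment_ne_zero hij e) ?_
      linear_combination ((e + 2 : ℕ) : MvPolynomial (Fin n) ℂ) * H - h * hrec -
        sMoment n (e + 1) (X i) (X j ^ 2) * hw
    have hXj : ¬ (X j : MvPolynomial (Fin n) ℂ) ∣ sMoment n (e + 1) (X i) (X j ^ 2) := by
      rintro ⟨r, hr⟩
      refine eval_sMoment_ne_zero hij (e + 1) ?_
      rw [hr]
      simp [hij.symm]
    obtain ⟨u, rfl⟩ := (X_prime (i := j)).pow_dvd_of_dvd_mul_left 2 hXj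
      (show (X j : MvPolynomial (Fin n) ℂ) ^ 2 ∣ sMoment n (e + 1) (X i) (X j ^ 2) * w from
        ⟨-h, by rw [hw']; ring⟩)
    refine ⟨-u, mul_left_cancel₀ (pow_ne_zero 2 (X_ne_zero j)) ?_⟩
    linear_combination hw'

lemma eq_zero_of_syzygy {i j : Fin n} (hij : i ≠ j) {e : ℕ} (he : 2 ≤ e)
    {h k : MvPolynomial (Fin n) ℂ} (hh : h ∈ homogeneousSubmodule (Fin n) ℂ 1)
    (H : h * sMoment n (e + 1) (X i) (X j ^ 2) + k * sMoment n e (X i) (X j ^ 2) = 0) :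
    h = 0 ∧ k = 0 := by
  have hs0 := sMoment_ne_zero hij e
  have hh0 : h = 0 := by
    by_contra hne
    have hmem : (sMoment n e (X i) (X j ^ 2)).IsHomogeneous e :=
      sMoment_mem (isHomogeneous_X ℂ i) (isHomogeneous_X_pow j 2)
    have h1 := hmem.totalDegree hs0
    have h2 := IsHomogeneous.totalDegree hh hne
    obtain ⟨w, rfl⟩ := sMoment_dvd_of_syzygy hij e h k H
    rw [totalDegree_mul_of_isDomain hs0 (right_ne_zero_of_mul hne)] at h2
    omega
  subst hh0
  simpa [hs0] using H

end Injectivity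

section MomentMap

variable {n : ℕ}

/-- Pairs consisting of a linear form and a quadratic form. -/
abbrev MomentParam (n : ℕ) : Type :=
  homogeneousSubmodule (Fin n) ℂ 1 × homogeneousSubmodule (Fin n) ℂ 2

/-- The moment map `(ℓ, q) ↦ s_d(ℓ, q)`. -/
def momentMap (n d : ℕ) (p : MomentParam n) : homogeneousSubmodule (Fin n) ℂ d :=
  ⟨sMoment n d p.1 p.2, sMoment_mem p.1.2 p.2.2⟩

/-- The differential of `momentMap n (e + 2)` at `p`. -/
def momentDeriv (n e : ℕ) (p : MomentParam n) :
    MomentParam n →ₗ[ℂ] homogeneousSubmodule (Fin n) ℂ (e + 2) where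
  toFun u := ⟨u.1 * sMoment n (e + 1) p.1 p.2 + (2⁻¹ : ℂ) • (u.2 * sMoment n e p.1 p.2), by
    refine Submodule.add_mem _ ?_ (Submodule.smul_mem _ _ ?_)
    · have := IsHomogeneous.mul u.1.2 (sMoment_mem (d := e + 1) p.1.2 p.2.2)
      rwa [show 1 + (e + 1) = e + 2 by ring] at this
    · have := IsHomogeneous.mul u.2.2 (sMoment_mem (d := e) p.1.2 p.2.2)
      rwa [show 2 + e = e + 2 by ring] at this⟩
  map_add' u v := by
    ext1
    simp only [Prod.fst_add, Prod.snd_add, Submodule.coe_add, add_mul, smul_add]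
    ring
  map_smul' c u := by
    ext1
    simp only [Prod.smul_fst, Prod.smul_snd, Submodule.coe_smul, smul_mul_assoc, smul_add,
      smul_comm c (2⁻¹ : ℂ), RingHom.id_apply]

lemma coe_momentDeriv (e : ℕ) (p u : MomentParam n) :
    (momentDeriv n e p u : MvPolynomial (Fin n) ℂ) =
      u.1 * sMoment n (e + 1) p.1 p.2 + (2⁻¹ : ℂ) • (u.2 * sMoment n e p.1 p.2) :=
  rfl

lemma isPolyMap_fst : IsPolyMap fun p : MomentParam n => (p.1 : MvPolynomial (Fin n) ℂ) :=
  IsPolyMap.linear ((homogeneousSubmodule (Fin n) ℂ 1).subtype ∘ₗ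
    LinearMap.fst ℂ (homogeneousSubmodule (Fin n) ℂ 1) (homogeneousSubmodule (Fin n) ℂ 2))

lemma isPolyMap_snd : IsPolyMap fun p : MomentParam n => (p.2 : MvPolynomial (Fin n) ℂ) :=
  IsPolyMap.linear ((homogeneousSubmodule (Fin n) ℂ 2).subtype ∘ₗ
    LinearMap.snd ℂ (homogeneousSubmodule (Fin n) ℂ 1) (homogeneousSubmodule (Fin n) ℂ 2))

lemma isPolyMap_momentMap (n d : ℕ) : IsPolyMap (momentMap n d) :=
  IsPolyMap.codRestrict (isPolyMap_sMoment isPolyMap_fst isPolyMap_snd d)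

lemma isPolyMap_momentDeriv (e : ℕ) (u : MomentParam n) :
    IsPolyMap fun p => momentDeriv n e p u :=
  IsPolyMap.codRestrict <|
    ((IsPolyMap.const _).mul (isPolyMap_sMoment isPolyMap_fst isPolyMap_snd (e + 1))).add
      (((IsPolyMap.const _).mul (isPolyMap_sMoment isPolyMap_fst isPolyMap_snd e)).const_smul _)

lemma hasLinearPart_momentMap (e : ℕ) (p v : MomentParam n) :
    HasLinearPart (fun t : ℂ => momentMap n (e + 2) (p + t • v)) (momentMap n (e + 2) p)
      (momentDeriv n e p v) :=
  HasLinearPart.codRestrict (hasLinearPart_sMoment e _ _ _ _)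

lemma injective_momentDeriv {i j : Fin n} (hij : i ≠ j) {e : ℕ} (he : 2 ≤ e) :
    Function.Injective (momentDeriv n e
      (⟨X i, isHomogeneous_X ℂ i⟩, ⟨X j ^ 2, isHomogeneous_X_pow j 2⟩)) := by
  rw [← LinearMap.ker_eq_bot, LinearMap.ker_eq_bot']
  rintro ⟨h, k⟩ H
  have H' := congrArg Subtype.val H
  rw [coe_momentDeriv, ← smul_mul_assoc] at H'
  obtain ⟨hh, hk⟩ := eq_zero_of_syzygy hij he h.2 H'
  refine Prod.ext (Subtype.ext hh) (Subtype.ext ?_)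
  simpa using hk

lemma finrank_momentParam (n : ℕ) : Module.finrank ℂ (MomentParam n) = n * (n + 3) / 2 := by
  rw [Module.finrank_prod, finrank_homogeneousSubmodule, finrank_homogeneousSubmodule,
    Nat.add_sub_cancel, Nat.choose_one_right, show n + 2 - 1 = n + 1 by omega,
    Nat.choose_two_right, Nat.add_sub_cancel]
  have : n * (n + 3) = (n + 1) * n + 2 * n := by ring
  omega

/-- Linear substitutions acting on forms of degree `d`. -/
def substForm (d : ℕ) (M : Matrix (Fin n) (Fin n) ℂ) :
    homogeneousSubmodule (Fin n) ℂ d →ₗ[ℂ] homogeneousSubmodule (Fin n) ℂ d :=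
  (substMatrix M).toLinearMap.restrict fun _ => substMatrix_mem M

lemma coe_substForm {d : ℕ} (M : Matrix (Fin n) (Fin n) ℂ)
    (v : homogeneousSubmodule (Fin n) ℂ d) :
    (substForm d M v : MvPolynomial (Fin n) ℂ) = substMatrix M v :=
  rfl

lemma isPolyMap_substForm {d : ℕ} (M N : Matrix (Fin n) (Fin n) ℂ)
    (v : homogeneousSubmodule (Fin n) ℂ d) :
    IsPolyMap fun t : ℂ => substForm d (M + t • N) v :=
  IsPolyMap.codRestrict (isPolyMap_substMatrix M N v)

lemma substForm_momentDeriv (e : ℕ) (M : Matrix (Fin n) (Fin n) ℂ) (p u : MomentParam n) :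
    substForm (e + 2) M (momentDeriv n e p u) =
      momentDeriv n e (substForm 1 M p.1, substForm 2 M p.2)
        (substForm 1 M u.1, substForm 2 M u.2) := by
  ext1
  simp only [coe_momentDeriv, coe_substForm, map_add, map_mul, map_smul, substMatrix_sMoment]

lemma GMVariety_eq (n d : ℕ) : GMVariety n d = zClosureV (Set.range (momentMap n d)) := by
  rw [GMVariety]
  congr 1
  ext f
  constructor
  · rintro ⟨ℓ, q, hℓ, hq, hf⟩
    exact ⟨(⟨ℓ, hℓ⟩, ⟨q, hq⟩), Subtype.ext hf.symm⟩
  · rintro ⟨p, rfl⟩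
    exact ⟨p.1, p.2, p.1.2, p.2.2, rfl⟩

end MomentMap

theorem stmt_14 (n d : ℕ) (hn : 2 ≤ n) (hd : 5 ≤ d)
    (N : ℕ) (hN : N = n * (n + 3) / 2) :
    zDimV (GMVariety n d) = (N : WithBot ℕ∞) ∧
    (∀ m : ℕ, 1 ≤ m → N * (m + N) ≤ Nat.choose (n + d - 1) d →
      zDimV (secantV m (GMVariety n d)) = ((m * N : ℕ) : WithBot ℕ∞)) ∧
    (∀ m : ℕ, 1 ≤ m → Nat.choose (n + d - 1) d + N ^ 2 ≤ m * N →
      secantV m (GMVariety n d) = Set.univ) := by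
  obtain ⟨e, rfl⟩ : ∃ e, d = e + 2 := ⟨d - 2, by omega⟩
  have hij : (⟨0, by omega⟩ : Fin n) ≠ ⟨1, by omega⟩ := by simp
  have hinj := injective_momentDeriv hij (e := e) (by omega)
  have hNP : N = Module.finrank ℂ (MomentParam n) := hN.trans (finrank_momentParam n).symm
  have hpos : 0 < Module.finrank ℂ (MomentParam n) := by
    rw [finrank_momentParam]
    exact Nat.div_pos (by nlinarith) two_pos
  have key := secantV_range_nondefective (isPolyMap_momentMap n (e + 2)) (isPolyMap_momentDeriv e)
    (hasLinearPart_momentMap e) hinj hpos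
    (M := Matrix (Fin n) (Fin n) ℂ) (fun M p => (substForm 1 M p.1, substForm 2 M p.2))
    (substForm (e + 2)) 1
    (fun g p => (isPolyMap_substForm 1 g p.1).prodMk (isPolyMap_substForm 1 g p.2))
    (fun g v => isPolyMap_substForm 1 g v)
    (fun p => Prod.ext (Subtype.ext (substMatrix_one _)) (Subtype.ext (substMatrix_one _)))
    (fun g p u => ⟨_, (substForm_momentDeriv e g p u).symm⟩)
    (fun v hv W hW => eq_top_of_substMatrix_mem (fun h => hv (Subtype.ext h)) v.2 W hW)
  rw [finrank_homogeneousSubmodule, ← hNP] at key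
  simp only [GMVariety_eq, secantV_zClosureV]
  refine ⟨?_, fun m _ => (key m).1, fun m _ => (key m).2⟩
  rw [hNP]
  exact zDimV_zClosureV_range (isPolyMap_momentMap n (e + 2)) (hasLinearPart_momentMap e) hinj
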